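/- There exists a dimensional constant θ(n) > 0 with the following property. Let E ⊆ B_R ⊂ ℝⁿ be a set of finite perimeter with 0 ∈ ∂E which is one-sided minimizing in B_R, i.e. Pe(E,B_R) ≤ Pe(F,B_R) for every measurable F with E ⊆ F and F∖E compactly contained in B_R. Then |B_r ∖ E| ≥ θ rⁿ for every 0 < r < R. -/

import Mathlib

open MeasureTheory Metric Filter Set Bornology
open scoped ENNReal NNReal symmDiff Topology RealInnerProductSpace

noncomputable section

/-- `n`-dimensional Euclidean space. -/
abbrev Eucl (n : ℕ) : Type := EuclideanSpace ℝ (Fin n)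

/-- A set has `C¹` boundary: near each boundary point it is the sublevel set of a `C¹`
function with nonvanishing differential. -/
def HasC1Boundary {n : ℕ} (E : Set (Eucl n)) : Prop :=
  ∀ x ∈ frontier E, ∃ (U : Set (Eucl n)) (f : Eucl n → ℝ),
    IsOpen U ∧ x ∈ U ∧ ContDiff ℝ 1 f ∧ (∀ y ∈ U, fderiv ℝ f y ≠ 0) ∧
    E ∩ U = {y | y ∈ U ∧ f y ≤ 0}

/-- `E` has a `C^{1,1}` boundary near the point `x`: locally it is the sublevel set of a `C¹`
function, with Lipschitz differential, and nonvanishing differential. -/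
def C11At {n : ℕ} (E : Set (Eucl n)) (x : Eucl n) : Prop :=
  ∃ (U : Set (Eucl n)) (f : Eucl n → ℝ) (K : ℝ≥0),
    IsOpen U ∧ x ∈ U ∧ ContDiff ℝ 1 f ∧ LipschitzOnWith K (fderiv ℝ f) U ∧
    (∀ y ∈ U, fderiv ℝ f y ≠ 0) ∧ E ∩ U = {y | y ∈ U ∧ f y ≤ 0}

/-- A set has `C^{1,1}` boundary. -/
def HasC11Boundary {n : ℕ} (E : Set (Eucl n)) : Prop :=
  ∀ x ∈ frontier E, C11At E x

/-- The (relative) perimeter of `E` in the open set `O`, defined à la De Giorgi as the least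
`liminf` of the `(n-1)`-dimensional Hausdorff measures of the boundaries of smooth
approximations converging to `E` in `L¹(O)`. -/
def Pe {n : ℕ} (E O : Set (Eucl n)) : ℝ≥0∞ :=
  sInf { p : ℝ≥0∞ | ∃ Ej : ℕ → Set (Eucl n),
    (∀ j, HasC1Boundary (Ej j)) ∧
    Tendsto (fun j => volume (((Ej j) ∆ E) ∩ O)) atTop (nhds 0) ∧
    p = Filter.liminf (fun j => μH[(n : ℝ) - 1] (frontier (Ej j) ∩ O)) atTop }

/-- Total perimeter. -/
def PeT {n : ℕ} (E : Set (Eucl n)) : ℝ≥0∞ := Pe E Set.univ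

/-- A Caccioppoli set: measurable, with finite perimeter. -/
def IsCaccioppoli {n : ℕ} (E : Set (Eucl n)) : Prop :=
  MeasurableSet E ∧ PeT E < ⊤

/-- A minimizing hull: `E` minimizes perimeter with respect to all sets containing it which
coincide with `E` outside a bounded set. -/
def IsMinimizingHull {n : ℕ} (E : Set (Eucl n)) : Prop :=
  ∀ F : Set (Eucl n), MeasurableSet F → E ⊆ F → IsBounded (F \ E) → PeT E ≤ PeT F

/-- Signed distance from the boundary of `F` (negative inside, positive outside). -/
def sdist {n : ℕ} (F : Set (Eucl n)) (x : Eucl n) : ℝ :=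
  haveI := Classical.dec (x ∈ F)
  if x ∈ F then -infDist x (frontier F) else infDist x (frontier F)

/-- The Almgren–Taylor–Wang functional `G(E, h, F) = Pe(E) + h⁻¹ ∫_E d_{∂F}`. -/
def Gfun {n : ℕ} (h : ℝ) (F E : Set (Eucl n)) : EReal :=
  (PeT E : EReal) + (((h⁻¹ * ∫ x in E, sdist F x) : ℝ) : EReal)

/-- `E` is a minimizer of `G(·, h, F)` among Caccioppoli sets containing `Ω` a.e. -/
def IsGMin {n : ℕ} (Ω : Set (Eucl n)) (h : ℝ) (F E : Set (Eucl n)) : Prop :=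
  IsCaccioppoli E ∧ volume (Ω \ E) = 0 ∧
  ∀ E' : Set (Eucl n), IsCaccioppoli E' → volume (Ω \ E') = 0 →
    Gfun h F E ≤ Gfun h F E'

/-- `E` is the maximal minimizer of `G(·, h, F)`: it contains every other minimizer up to a
null set. -/
def IsMaxGMin {n : ℕ} (Ω : Set (Eucl n)) (h : ℝ) (F E : Set (Eucl n)) : Prop :=
  IsGMin Ω h F E ∧ ∀ E' : Set (Eucl n), IsGMin Ω h F E' → volume (E' \ E) = 0

/-- A discrete (in time) flow with obstacle `Ω`, initial set `E₀` and time step `h`. -/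
def IsDiscreteFlow {n : ℕ} (Ω E₀ : Set (Eucl n)) (h : ℝ) (E : ℕ → Set (Eucl n)) : Prop :=
  E 0 = E₀ ∧ ∀ i : ℕ, IsGMin Ω h (E i) (E (i + 1))

/-- The maximal discrete flow: each step is the maximal minimizer. -/
def IsMaxFlow {n : ℕ} (Ω E₀ : Set (Eucl n)) (h : ℝ) (E : ℕ → Set (Eucl n)) : Prop :=
  E 0 = E₀ ∧ ∀ i : ℕ, IsMaxGMin Ω h (E i) (E (i + 1))

/-- Normalized pointwise representative of a Caccioppoli set:
`x ∈ ∂E ↔ 0 < |B_r(x) ∩ E| < ω_n rⁿ` for all `r > 0`. -/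
def IsNormalized {n : ℕ} (E : Set (Eucl n)) : Prop :=
  ∀ x : Eucl n, x ∈ frontier E ↔
    ∀ r : ℝ, 0 < r → 0 < volume (E ∩ ball x r) ∧ volume (E ∩ ball x r) < volume (ball x r)

/-- Divergence of a vector field on Euclidean space. -/
def vdiv {n : ℕ} (V : Eucl n → Eucl n) (x : Eucl n) : ℝ :=
  ∑ i : Fin n, ⟪fderiv ℝ V x (EuclideanSpace.single i (1 : ℝ)),
    EuclideanSpace.single i (1 : ℝ)⟫

/-- The unit normal field of the level sets of `f`. -/
def unitNormalField {n : ℕ} (f : Eucl n → ℝ) (x : Eucl n) : Eucl n :=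
  ‖gradient f x‖⁻¹ • gradient f x

/-- `S` is, near each of its points, a smooth hypersurface with vanishing mean curvature
(the mean curvature being the divergence of the unit normal of a local level-set
representation). -/
def IsMinimalLocally {n : ℕ} (S : Set (Eucl n)) : Prop :=
  ∀ x ∈ S, ∃ (U : Set (Eucl n)) (f : Eucl n → ℝ),
    IsOpen U ∧ x ∈ U ∧ ContDiff ℝ (⊤ : ℕ∞) f ∧ (∀ y ∈ U, gradient f y ≠ 0) ∧
    S ∩ U = {y | y ∈ U ∧ f y = 0} ∧
    ∀ y ∈ S ∩ U, vdiv (unitNormalField f) y = 0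

/-- `S` is a compact smooth embedded minimal hypersurface with boundary `B`:
away from `B`, each point of `S` has a neighbourhood in which `S` is a smooth level set
whose unit normal field is divergence free (vanishing mean curvature). -/
def IsMinimalHypersurface {n : ℕ} (S B : Set (Eucl n)) : Prop :=
  IsCompact S ∧ IsClosed B ∧ B ⊆ S ∧
  ∀ x ∈ S \ B, ∃ (U : Set (Eucl n)) (f : Eucl n → ℝ),
    IsOpen U ∧ x ∈ U ∧ ContDiff ℝ (⊤ : ℕ∞) f ∧ (∀ y ∈ U, gradient f y ≠ 0) ∧
    S ∩ U = {y | y ∈ U ∧ f y = 0} ∧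
    ∀ y ∈ S ∩ U, vdiv (unitNormalField f) y = 0

/-- A global barrier: it contains every compact minimal hypersurface whose boundary it
contains. -/
def IsGlobalBarrier {n : ℕ} (Θ : Set (Eucl n)) : Prop :=
  ∀ S B : Set (Eucl n), IsMinimalHypersurface S B → B ⊆ Θ → S ⊆ Θ

/-- The mean-convex hull: the intersection of all global barriers containing `Ω`. -/
def mcHull {n : ℕ} (Ω : Set (Eucl n)) : Set (Eucl n) :=
  ⋂₀ { Θ : Set (Eucl n) | IsGlobalBarrier Θ ∧ Ω ⊆ Θ }

/-- A closed set with `C^{1,1}` boundary is mean-convex: the mean curvature vector points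
inward a.e., i.e. the divergence of the outer unit normal is nonnegative at every boundary
point where it is defined. -/
def IsMeanConvex {n : ℕ} (Ω : Set (Eucl n)) : Prop :=
  ∀ x ∈ frontier Ω, ∃ (U : Set (Eucl n)) (f : Eucl n → ℝ) (K : ℝ≥0),
    IsOpen U ∧ x ∈ U ∧ ContDiff ℝ 1 f ∧ LipschitzOnWith K (fderiv ℝ f) U ∧
    (∀ y ∈ U, gradient f y ≠ 0) ∧ Ω ∩ U = {y | y ∈ U ∧ f y ≤ 0} ∧
    ∀ y ∈ frontier Ω ∩ U, DifferentiableAt ℝ (unitNormalField f) y →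
      0 ≤ vdiv (unitNormalField f) y

/-- `‖A_{∂E}‖_{L^∞} ≤ M`: at every boundary point where the (outer unit normal) gradient of
the signed distance function is differentiable, the norm of its derivative (which realizes
the second fundamental form of `∂E`) is at most `M`. -/
def ANormLe {n : ℕ} (E : Set (Eucl n)) (M : ℝ) : Prop :=
  ∀ x ∈ frontier E, DifferentiableAt ℝ (gradient (sdist E)) x →
    ‖fderiv ℝ (gradient (sdist E)) x‖ ≤ M

/-- `X` is an outcome `𝓔(Ω)` of the obstacle mean curvature flow construction: the
intersection over `ε` of the asymptotic limits `E^ε_{max,∞} = ⋃_{h>0} ⋂_i E^{(h),ε}_{max,i}`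
of the maximal flows with obstacle `Ω_ε = {dist(·,Ω) ≤ ε}`, started from a fixed closed
convex set `E₀` compactly containing the `Ω_ε`. -/
def IsCalE {n : ℕ} (Ω X : Set (Eucl n)) : Prop :=
  ∃ (ε₀ : ℝ) (E₀ : Set (Eucl n)) (Fl : ℝ → ℝ → ℕ → Set (Eucl n)),
    0 < ε₀ ∧ IsClosed E₀ ∧ Convex ℝ E₀ ∧ IsBounded E₀ ∧
    (∀ ε ∈ Ioo (0 : ℝ) ε₀, HasC11Boundary (cthickening ε Ω) ∧
      cthickening ε Ω ⊆ interior E₀) ∧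
    (∀ ε ∈ Ioo (0 : ℝ) ε₀, ∀ h : ℝ, 0 < h → IsMaxFlow (cthickening ε Ω) E₀ h (Fl ε h)) ∧
    X = ⋂ ε ∈ Ioo (0 : ℝ) ε₀, ⋃ h ∈ Ioi (0 : ℝ), ⋂ i, Fl ε h i


/-- Discrete growth argument: a monotone positive function that at least doubles after each
step of length `K * y ρ` grows at least linearly. -/
theorem growth_of_doubling {y : ℝ → ℝ} {K r : ℝ} (hK : 0 < K)
    (hpos : ∀ s, 0 < s → 0 < y s) (hmono : ∀ s t, 0 < s → s ≤ t → y s ≤ y t)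
    (hdouble : ∀ s, 0 < s → s + K * y s ≤ r → 2 * y s ≤ y (s + K * y s)) :
    ∀ s, 0 < s → s ≤ r → r - s ≤ 2 * K * y r - K * y s := by
  intro s₀ hs₀ _
  have key : ∀ N : ℕ, ∀ s, s₀ ≤ s → s ≤ r → r - s ≤ N * (K * y s₀) →
      r - s ≤ 2 * K * y r - K * y s := by
    intro N
    induction N with
    | zero =>
      intro s hs hsr h
      have h1 := hmono s r (by linarith) hsr
      have h2 := hpos r (by linarith)
      have : r - s ≤ 0 := by simpa using h
      nlinarith [mul_le_mul_of_nonneg_left h1 hK.le, mul_pos hK h2]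
    | succ N ih =>
      intro s hs hsr h
      have hsp : 0 < s := by linarith
      have h1 := hmono s r hsp hsr
      have h0 := hmono s₀ s hs₀ hs
      have hKs : K * y s₀ ≤ K * y s := mul_le_mul_of_nonneg_left h0 hK.le
      have hKr : K * y s ≤ K * y r := mul_le_mul_of_nonneg_left h1 hK.le
      have hKp : 0 < K * y s := mul_pos hK (hpos s hsp)
      by_cases hc : s + K * y s ≤ r
      · have hd := hdouble s hsp hc
        have := ih (s + K * y s) (by linarith) hc (by push_cast at h; linarith)
        have hd' : 2 * (K * y s) ≤ K * y (s + K * y s) := by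
          have := mul_le_mul_of_nonneg_left hd hK.le
          linarith
        linarith
      · push Not at hc
        linarith
  obtain ⟨N, hN⟩ := exists_nat_ge ((r - s₀) / (K * y s₀))
  refine key N s₀ le_rfl ‹_› ?_
  exact (div_le_iff₀ (mul_pos hK (hpos s₀ hs₀))).1 hN

/-- A positive monotone function satisfying a relative isoperimetric growth inequality
is bounded below by a multiple of the `n`-th power. -/
theorem growth_pow {m : ℕ} {C : ℝ} (hC : 0 < C) :
    ∃ θ : ℝ, 0 < θ ∧ ∀ (M : ℝ → ℝ) (R : ℝ), (∀ s, 0 < s → 0 < M s) →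
      (∀ s t, 0 < s → s ≤ t → M s ≤ M t) →
      (∀ s t, 0 < s → s < t → t < R → M s ^ m * (t - s) ^ (m + 1) ≤ C * M t ^ (m + 1)) →
      ∀ r, 0 < r → r < R → θ * r ^ (m + 1) ≤ M r := by
  set n := m + 1 with hn
  have hn0 : n ≠ 0 := by omega
  set K : ℝ := ((2 ^ n) ^ n * C) ^ ((n : ℝ)⁻¹) with hKdef
  have hK : 0 < K := by positivity
  have hKn : K ^ n = (2 ^ n) ^ n * C := by
    rw [hKdef, Real.rpow_inv_natCast_pow (by positivity) hn0]
  refine ⟨(1 / (4 * K)) ^ n, by positivity, ?_⟩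
  intro M R hpos hmono hgr r hr hrR
  set y : ℝ → ℝ := fun s => (M s) ^ ((n : ℝ)⁻¹) with hy
  have hyn : ∀ s, 0 < s → y s ^ n = M s := fun s hs => by
    simp only [hy]; rw [Real.rpow_inv_natCast_pow (hpos s hs).le hn0]
  have hypos : ∀ s, 0 < s → 0 < y s := fun s hs => Real.rpow_pos_of_pos (hpos s hs) _
  have hymono : ∀ s t, 0 < s → s ≤ t → y s ≤ y t := fun s t hs hst =>
    Real.rpow_le_rpow (hpos s hs).le (hmono s t hs hst) (by positivity)
  have hd : ∀ s, 0 < s → s + K * y s ≤ r → 2 * y s ≤ y (s + K * y s) := by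
    intro s hs hsr
    have hKy : 0 < K * y s := mul_pos hK (hypos s hs)
    have h := hgr s (s + K * y s) hs (by linarith) (by linarith)
    rw [add_sub_cancel_left, mul_pow, hKn, hyn s hs] at h
    have hMs := hpos s hs
    have h2 : (2 ^ n) ^ n * (M s) ^ n ≤ M (s + K * y s) ^ n := by
      have e : M s ^ m * ((2 ^ n) ^ n * C * M s) = C * ((2 ^ n) ^ n * M s ^ n) := by
        rw [hn, pow_succ (M s) m]; ring
      rw [e] at h
      exact le_of_mul_le_mul_left h hC
    rw [← mul_pow] at h2
    have h3 : 2 ^ n * M s ≤ M (s + K * y s) :=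
      le_of_pow_le_pow_left₀ hn0 (hpos _ (by linarith)).le h2
    rw [← hyn s hs, ← hyn (s + K * y s) (by linarith), ← mul_pow] at h3
    exact le_of_pow_le_pow_left₀ hn0 (hypos _ (by linarith)).le h3
  have := growth_of_doubling hK hypos hymono hd (r / 2) (by linarith) (by linarith)
  have h5 : r * (1 / (4 * K)) ≤ y r := by
    have := mul_pos hK (hypos (r/2) (by linarith))
    rw [mul_one_div, div_le_iff₀ (by positivity)]
    linarith
  calc (1 / (4 * K)) ^ n * r ^ n = (r * (1 / (4 * K))) ^ n := by rw [mul_pow, mul_comm]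
    _ ≤ y r ^ n := by gcongr
    _ = M r := hyn r hr

/-- Forget the `i`-th coordinate. -/
def dropCoord {m : ℕ} (i : Fin (m + 1)) (x : Fin (m + 1) → ℝ) : Fin m → ℝ :=
  fun j => x (i.succAbove j)

theorem isOpenMap_dropCoord {m : ℕ} (i : Fin (m + 1)) : IsOpenMap (dropCoord i) := by
  let L : (Fin (m + 1) → ℝ) →L[ℝ] (Fin m → ℝ) :=
    ContinuousLinearMap.pi fun j => ContinuousLinearMap.proj (i.succAbove j)
  have hL : Function.Surjective L := fun y => ⟨i.insertNth 0 y, by ext j; simp [L]⟩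
  exact L.isOpenMap hL

theorem measurable_volume_cons_slice {k : ℕ} {B : Set (Fin (k + 1) → ℝ)} (hB : MeasurableSet B) :
    Measurable (fun t : ℝ => volume {y : Fin k → ℝ | (Fin.cons t y : Fin (k + 1) → ℝ) ∈ B}) ∧
    volume B = ∫⁻ t : ℝ, volume {y : Fin k → ℝ | (Fin.cons t y : Fin (k + 1) → ℝ) ∈ B} := by
  set e := MeasurableEquiv.piFinSuccAbove (fun _ : Fin (k + 1) => ℝ) 0
  have he := (volume_preserving_piFinSuccAbove (fun _ : Fin (k + 1) => ℝ) 0).symm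
  have hB' : MeasurableSet (e.symm ⁻¹' B) := e.symm.measurable hB
  have hs : ∀ t : ℝ, Prod.mk t ⁻¹' (e.symm ⁻¹' B) =
      {y : Fin k → ℝ | (Fin.cons t y : Fin (k + 1) → ℝ) ∈ B} := by
    intro t; ext y
    simp [e, MeasurableEquiv.piFinSuccAbove, Fin.consEquiv]
  constructor
  · have := measurable_measure_prodMk_left (ν := (volume : Measure (Fin k → ℝ))) hB'
    simpa only [hs] using this
  · rw [← he.measure_preimage hB.nullMeasurableSet, Measure.volume_eq_prod,
      Measure.prod_apply hB']
    exact lintegral_congr fun t => by rw [hs t]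

/-- The Loomis–Whitney inequality for open sets. -/
theorem loomis_whitney : ∀ (m : ℕ) (A : Set (Fin (m + 1) → ℝ)), IsOpen A → A.Nonempty →
    volume A ^ m ≤ ∏ i : Fin (m + 1), volume (dropCoord i '' A) := by
  intro m
  induction m with
  | zero =>
    intro A hA hne
    have : dropCoord (0 : Fin 1) '' A = univ := by
      ext x
      simp only [mem_univ, iff_true]
      exact ⟨hne.some, hne.some_mem, Subsingleton.elim _ _⟩
    simp [this, volume_pi]
  | succ m ih =>
    intro A hA hne
    set p : ℝ := ((m + 1 : ℕ) : ℝ)⁻¹ with hp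
    have hp0 : 0 < p := by positivity
    set sl : ℝ → Set (Fin (m + 1) → ℝ) := fun t => {y | (Fin.cons t y : Fin (m + 2) → ℝ) ∈ A} with hsl
    have hslo : ∀ t, IsOpen (sl t) := fun t => hA.preimage (by fun_prop)
    set g : Fin (m + 1) → ℝ → ℝ≥0∞ := fun i t =>
      volume {y : Fin m → ℝ | (Fin.cons t y : Fin (m + 1) → ℝ) ∈ dropCoord i.succ '' A} with hg
    have hopen : ∀ i, MeasurableSet (dropCoord i '' A) := fun i =>
      (isOpenMap_dropCoord i A hA).measurableSet
    have hpt : ∀ t, volume (sl t) ≤ volume (dropCoord 0 '' A) ^ p * ∏ i, g i t ^ p := by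
      intro t
      rcases (sl t).eq_empty_or_nonempty with h0 | h0
      · simp [h0]
      have h1 : volume (sl t) ≤ volume (dropCoord 0 '' A) := by
        apply measure_mono
        intro y hy
        exact ⟨_, hy, by ext j; simp [dropCoord]⟩
      have h2 : volume (sl t) ^ m ≤ ∏ i, g i t := by
        refine (ih _ (hslo t) h0).trans ?_
        refine Finset.prod_le_prod' fun i _ => measure_mono ?_
        rintro _ ⟨y, hy, rfl⟩
        refine ⟨_, hy, ?_⟩
        ext j
        refine Fin.cases ?_ (fun j => ?_) j <;> simp [dropCoord]
      have h3 : volume (sl t) ^ (m + 1) ≤ volume (dropCoord 0 '' A) * ∏ i, g i t := by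
        rw [pow_succ, mul_comm]; gcongr
      have h4 := ENNReal.rpow_le_rpow h3 hp0.le
      rw [ENNReal.mul_rpow_of_nonneg _ _ hp0.le, ← ENNReal.prod_rpow_of_nonneg hp0.le,
        hp, ENNReal.pow_rpow_inv_natCast (by omega)] at h4
      exact h4
    have hA1 := (measurable_volume_cons_slice hA.measurableSet).2
    have h5 : volume A ≤ volume (dropCoord 0 '' A) ^ p *
        ∏ i : Fin (m + 1), volume (dropCoord i.succ '' A) ^ p := by
      rw [hA1]
      refine (lintegral_mono hpt).trans ?_
      rw [lintegral_const_mul]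
      · gcongr
        refine (ENNReal.lintegral_prod_norm_pow_le (μ := volume) (Finset.univ : Finset (Fin (m + 1)))
          (f := g) (p := fun _ => p) ?_ ?_ ?_).trans ?_
        · intro i _
          exact (measurable_volume_cons_slice (hopen i.succ)).1.aemeasurable
        · simp [hp]; field_simp
        · intro i _; exact hp0.le
        · refine Finset.prod_le_prod' fun i _ => ?_
          rw [(measurable_volume_cons_slice (hopen i.succ)).2]
      · exact Finset.measurable_prod _ fun i _ =>
          (measurable_volume_cons_slice (hopen i.succ)).1.pow_const p
    have h6 := pow_le_pow_left' h5 (m + 1)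
    rw [mul_pow, ← Finset.prod_pow] at h6
    simp only [hp] at h6
    rw [Fin.prod_univ_succ]
    refine h6.trans (le_of_eq ?_)
    congr 1
    · rw [ENNReal.rpow_inv_natCast_pow]; omega
    · refine Finset.prod_congr rfl fun i _ => ?_
      rw [ENNReal.rpow_inv_natCast_pow]; omega

/-- A line segment from a point of `A` to a point outside `A` meets the frontier of `A`. -/
theorem exists_frontier_on_segment {E : Type*} [NormedAddCommGroup E] [NormedSpace ℝ E]
    {A : Set E} {x v : E} {a b : ℝ} (hab : a ≤ b)
    (h : (x + a • v ∈ A ∧ x + b • v ∉ A) ∨ (x + a • v ∉ A ∧ x + b • v ∈ A)) :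
    ∃ t ∈ Icc a b, x + t • v ∈ frontier A := by
  have hc : ContinuousOn (fun t : ℝ => x + t • v) (Icc a b) := by fun_prop
  have hpre : IsPreconnected ((fun t : ℝ => x + t • v) '' Icc a b) :=
    isPreconnected_Icc.image _ hc
  have ha : x + a • v ∈ (fun t : ℝ => x + t • v) '' Icc a b := ⟨a, ⟨le_rfl, hab⟩, rfl⟩
  have hb : x + b • v ∈ (fun t : ℝ => x + t • v) '' Icc a b := ⟨b, ⟨hab, le_rfl⟩, rfl⟩
  by_contra! hcon
  have hdisj : ∀ y ∈ (fun t : ℝ => x + t • v) '' Icc a b, y ∈ interior A ∨ y ∈ (closure A)ᶜ := by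
    rintro _ ⟨t, ht, rfl⟩
    have := hcon t ht
    rw [frontier, Set.mem_sdiff, not_and_not_right] at this
    by_cases hy : x + t • v ∈ closure A
    · exact Or.inl (this hy)
    · exact Or.inr hy
  have key := hpre (interior A) (closure A)ᶜ isOpen_interior isClosed_closure.isOpen_compl hdisj
  have hin : ∀ y ∈ (fun t : ℝ => x + t • v) '' Icc a b, y ∈ A → y ∈ interior A := fun y hy hA =>
    (hdisj y hy).resolve_right (fun h => h (subset_closure hA))
  have hout : ∀ y ∈ (fun t : ℝ => x + t • v) '' Icc a b, y ∉ A → y ∈ (closure A)ᶜ :=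
    fun y hy hA => (hdisj y hy).resolve_left (fun h => hA (interior_subset h))
  have : ((fun t : ℝ => x + t • v) '' Icc a b ∩ (interior A ∩ (closure A)ᶜ)).Nonempty := by
    rcases h with ⟨h1, h2⟩ | ⟨h1, h2⟩
    · exact key ⟨_, ha, hin _ ha h1⟩ ⟨_, hb, hout _ hb h2⟩
    · exact key ⟨_, hb, hin _ hb h2⟩ ⟨_, ha, hout _ ha h1⟩
  obtain ⟨y, -, hy1, hy2⟩ := this
  exact hy2 (subset_closure (interior_subset hy1))

/-- Isoperimetric inequality for bounded open sets, in terms of the Hausdorff measure of the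
topological boundary. -/
theorem volume_pow_le_hausdorffMeasure_frontier {m : ℕ} {A : Set (Eucl (m + 1))}
    (hA : IsOpen A) (hb : IsBounded A) (hne : A.Nonempty) :
    volume A ^ m ≤ (μH[(m : ℝ)] (frontier A)) ^ (m + 1) := by
  set A' : Set (Fin (m + 1) → ℝ) := WithLp.toLp 2 ⁻¹' A with hA'
  have hA'o : IsOpen A' := hA.preimage (by fun_prop)
  have hvol : volume A' = volume A :=
    (PiLp.volume_preserving_toLp (Fin (m + 1))).measure_preimage hA.measurableSet.nullMeasurableSet
  have hA'n : A'.Nonempty := ⟨hne.some.ofLp, hne.some_mem⟩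
  rw [← hvol]
  refine (loomis_whitney m A' hA'o hA'n).trans ?_
  suffices h : ∀ i : Fin (m + 1), volume (dropCoord i '' A') ≤ μH[(m : ℝ)] (frontier A) by
    refine (Finset.prod_le_prod' fun i _ => h i).trans ?_
    simp
  intro i
  set q : Eucl (m + 1) → (Fin m → ℝ) := fun x => dropCoord i x.ofLp with hq
  have hqL : LipschitzWith 1 q := by
    refine LipschitzWith.of_dist_le_mul fun x y => ?_
    rw [NNReal.coe_one, one_mul, dist_pi_le_iff dist_nonneg]
    intro j
    simp only [hq, dropCoord, dist_eq_norm]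
    have := PiLp.norm_apply_le (x - y) (i.succAbove j)
    simpa using this
  have hsub : dropCoord i '' A' ⊆ q '' frontier A := by
    rintro _ ⟨x, hx, rfl⟩
    obtain ⟨r, hr⟩ := hb.subset_closedBall (0 : Eucl (m + 1))
    set v : Eucl (m + 1) := EuclideanSpace.single i (1 : ℝ) with hv
    set X : Eucl (m + 1) := WithLp.toLp 2 x with hX
    have hvn : ‖v‖ = 1 := by simp [hv]
    set T : ℝ := |r| + ‖X‖ + 1 with hT
    have hT0 : 0 ≤ T := by positivity
    have hout : X + T • v ∉ A := by
      intro hmem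
      have h1 := hr hmem
      rw [mem_closedBall_zero_iff] at h1
      have h2 : ‖T • v‖ ≤ ‖X + T • v‖ + ‖X‖ := by
        have := norm_sub_le (X + T • v) X
        simpa using this
      rw [norm_smul, hvn, mul_one, Real.norm_of_nonneg hT0] at h2
      have := le_abs_self r
      linarith
    obtain ⟨t, -, ht⟩ := exists_frontier_on_segment (A := A) (x := X) (v := v) (a := 0) (b := T)
      hT0 (Or.inl ⟨by rw [zero_smul, add_zero]; exact hx, hout⟩)
    refine ⟨_, ht, ?_⟩
    ext j
    simp [hq, dropCoord, hv, hX]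
  calc volume (dropCoord i '' A') ≤ volume (q '' frontier A) := measure_mono hsub
    _ = μH[(m : ℝ)] (q '' frontier A) := by
      rw [← hausdorffMeasure_pi_real, Fintype.card_fin]
    _ ≤ _ := by
      have := hqL.hausdorffMeasure_image_le (d := (m : ℝ)) (by positivity) (frontier A)
      simpa using this

theorem LipschitzOnWith.ediam_image_inter_le {X Y : Type*} [PseudoEMetricSpace X]
    [PseudoEMetricSpace Y] {K : ℝ≥0} {f : X → Y} {A : Set X} (hf : LipschitzOnWith K f A)
    (s : Set X) : ediam (f '' (s ∩ A)) ≤ K * ediam s := by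
  apply ediam_image_le_iff.2
  intro x hx y hy
  exact (hf hx.2 hy.2).trans (by gcongr; exact edist_le_ediam_of_mem hx.1 hy.1)

/-- Eilenberg's inequality for real-valued Lipschitz functions, with a measurable majorant. -/
theorem eilenberg_inequality {X : Type*} [EMetricSpace X] [MeasurableSpace X] [BorelSpace X]
    {q : X → ℝ} {A : Set X} {K : ℝ≥0} (hq : LipschitzOnWith K q A) {d : ℝ} (hd : 0 ≤ d)
    (hA : μH[d + 1] A ≠ ⊤) :
    ∃ h : ℝ → ℝ≥0∞, Measurable h ∧ (∀ l, μH[d] {x | x ∈ A ∧ q x = l} ≤ h l) ∧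
      ∫⁻ l, h l ≤ K * μH[d + 1] A := by
  have hcov : ∀ k : ℕ, ∃ t : ℕ → Set X, A ⊆ ⋃ i, t i ∧
      (∀ i, ediam (t i) ≤ ((k : ℝ≥0∞) + 1)⁻¹) ∧
      ∑' i, ⨆ (_ : (t i).Nonempty), ediam (t i) ^ (d + 1) ≤ μH[d + 1] A + ((k : ℝ≥0∞) + 1)⁻¹ := by
    intro k
    have hk : (0 : ℝ≥0∞) < ((k : ℝ≥0∞) + 1)⁻¹ := by simp
    have h1 := Measure.hausdorffMeasure_apply (d + 1) A
    have h2 : (⨅ (t : ℕ → Set X) (_ : A ⊆ ⋃ n, t n) (_ : ∀ n, ediam (t n) ≤ ((k : ℝ≥0∞) + 1)⁻¹),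
        ∑' n, ⨆ (_ : (t n).Nonempty), ediam (t n) ^ (d + 1)) < μH[d + 1] A + ((k : ℝ≥0∞) + 1)⁻¹ := by
      refine lt_of_le_of_lt ?_ (ENNReal.lt_add_right hA hk.ne')
      rw [h1]
      exact le_iSup₂ (f := fun (r : ℝ≥0∞) (_ : 0 < r) =>
        ⨅ (t : ℕ → Set X) (_ : A ⊆ ⋃ n, t n) (_ : ∀ n, ediam (t n) ≤ r),
        ∑' n, ⨆ (_ : (t n).Nonempty), ediam (t n) ^ (d + 1)) _ hk
    simp only [iInf_lt_iff] at h2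
    obtain ⟨t, ht1, ht2, ht3⟩ := h2
    exact ⟨t, ht1, ht2, ht3.le⟩
  choose t ht1 ht2 ht3 using hcov
  set g : ℕ → ℝ → ℝ≥0∞ := fun k l =>
    ∑' i, (closure (q '' (t k i ∩ A))).indicator (fun _ => ediam (t k i) ^ d) l with hg
  have hmeas : ∀ k i, Measurable
      ((closure (q '' (t k i ∩ A))).indicator (fun _ : ℝ => ediam (t k i) ^ d)) := fun k i =>
    measurable_const.indicator isClosed_closure.measurableSet
  have hgm : ∀ k, Measurable (g k) := fun k => Measurable.tsum (hmeas k)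
  have htend : Tendsto (fun k : ℕ => ((k : ℝ≥0∞) + 1)⁻¹) atTop (𝓝 0) := by
    have := (tendsto_add_atTop_iff_nat 1).2 ENNReal.tendsto_inv_nat_nhds_zero
    simpa using this
  have hpt : ∀ l, μH[d] {x | x ∈ A ∧ q x = l} ≤ liminf (fun k => g k l) atTop := by
    intro l
    have h := Measure.hausdorffMeasure_le_liminf_tsum
      (ι := fun k => {i : ℕ // l ∈ closure (q '' (t k i ∩ A))}) d {x | x ∈ A ∧ q x = l}
      (l := atTop) _ htend (fun k i => t k i.1) (Eventually.of_forall fun k i => ht2 k i.1)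
      (Eventually.of_forall fun k x hx => by
        obtain ⟨i, hi⟩ := mem_iUnion.1 (ht1 k hx.1)
        exact mem_iUnion.2 ⟨⟨i, subset_closure ⟨x, ⟨hi, hx.1⟩, hx.2⟩⟩, hi⟩)
    refine h.trans (le_of_eq ?_)
    congr 1
    ext k
    simp only [hg]
    exact tsum_subtype {i | l ∈ closure (q '' (t k i ∩ A))} (fun i => ediam (t k i) ^ d)
  have hint : ∀ k, ∫⁻ l, g k l ≤ K * (μH[d + 1] A + ((k : ℝ≥0∞) + 1)⁻¹) := by
    intro k
    simp only [hg]
    rw [lintegral_tsum fun i => (hmeas k i).aemeasurable]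
    calc ∑' i, ∫⁻ l, (closure (q '' (t k i ∩ A))).indicator (fun _ => ediam (t k i) ^ d) l
        ≤ ∑' i, K * ⨆ (_ : (t k i).Nonempty), ediam (t k i) ^ (d + 1) := by
          refine ENNReal.tsum_le_tsum fun i => ?_
          rw [lintegral_indicator_const isClosed_closure.measurableSet]
          rcases (t k i).eq_empty_or_nonempty with h0 | h0
          · simp [h0]
          · simp only [h0, ciSup_pos]
            calc ediam (t k i) ^ d * volume (closure (q '' (t k i ∩ A)))
                ≤ ediam (t k i) ^ d * (K * ediam (t k i)) := by
                  gcongr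
                  refine (Real.volume_le_diam _).trans ?_
                  rw [ediam_closure]
                  exact hq.ediam_image_inter_le _
              _ = K * ediam (t k i) ^ (d + 1) := by
                  rw [ENNReal.rpow_add_of_nonneg _ _ hd zero_le_one, ENNReal.rpow_one]; ring
      _ = K * ∑' i, ⨆ (_ : (t k i).Nonempty), ediam (t k i) ^ (d + 1) := ENNReal.tsum_mul_left
      _ ≤ _ := by gcongr; exact ht3 k
  refine ⟨fun l => liminf (fun k => g k l) atTop, Measurable.liminf hgm, hpt, ?_⟩
  calc ∫⁻ l, liminf (fun k => g k l) atTop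
      ≤ liminf (fun k => ∫⁻ l, g k l) atTop := lintegral_liminf_le hgm
    _ ≤ liminf (fun k : ℕ => K * (μH[d + 1] A + ((k : ℝ≥0∞) + 1)⁻¹)) atTop :=
        liminf_le_liminf (Eventually.of_forall hint)
    _ = K * μH[d + 1] A := by
        apply Tendsto.liminf_eq
        have h1 : Tendsto (fun k : ℕ => μH[d + 1] A + ((k : ℝ≥0∞) + 1)⁻¹) atTop
            (𝓝 (μH[d + 1] A + 0)) := tendsto_const_nhds.add htend
        rw [add_zero] at h1
        exact ENNReal.Tendsto.const_mul h1 (Or.inr ENNReal.coe_ne_top)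

theorem hausdorffMeasure_eucl_eq_smul_volume (n : ℕ) :
    ∃ c : ℝ≥0, ∀ s : Set (Eucl n), μH[(n : ℝ)] s = c * volume s := by
  have hf : (μH[(n : ℝ)] : Measure (Eucl n)) = μH[(Module.finrank ℝ (Eucl n) : ℝ)] := by simp
  have : (μH[(n : ℝ)] : Measure (Eucl n)).IsAddHaarMeasure := by rw [hf]; infer_instance
  refine ⟨Measure.addHaarScalarFactor (μH[(n : ℝ)] : Measure (Eucl n)) volume, fun s => ?_⟩
  have := Measure.isAddLeftInvariant_eq_smul (μH[(n : ℝ)] : Measure (Eucl n)) volume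
  conv_lhs => rw [this]
  rfl

/-- Sard-type perturbation: subtracting a generic linear function from a `C²` function makes
almost every level regular. -/
theorem ae_ae_fderiv_sub_inner_ne_zero {n : ℕ} {q : Eucl n → ℝ} (hq : ContDiff ℝ 2 q) :
    ∀ᵐ a : Eucl n, ∀ᵐ l : ℝ, ∀ x, q x - ⟪a, x⟫ = l →
      fderiv ℝ (fun y => q y - ⟪a, y⟫) x ≠ 0 := by
  set Φ : Eucl n → Eucl n × ℝ := fun x => (gradient q x, q x - ⟪gradient q x, x⟫) with hΦ
  have hg : ContDiff ℝ 1 (gradient q) := by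
    have h1 : ContDiff ℝ 1 (fderiv ℝ q) := hq.fderiv_right (by norm_num)
    exact (InnerProductSpace.toDual ℝ (Eucl n)).symm.contDiff.comp h1
  have hΦc : ContDiff ℝ 1 Φ := hg.prodMk ((hq.of_le (by norm_num)).sub (hg.inner ℝ contDiff_id))
  have hdim : dimH (range Φ) ≤ n := by
    have := hΦc.dimH_range_le
    simpa using this
  have hnull : μH[((n + 1 : ℕ) : ℝ≥0)] (range Φ) = 0 := by
    apply hausdorffMeasure_of_dimH_lt
    refine hdim.trans_lt ?_
    push_cast
    exact_mod_cast Nat.lt_succ_self n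
  have hf : Module.finrank ℝ (Eucl n × ℝ) = n + 1 := by simp
  have hvol : volume (range Φ) = 0 := by
    have hh : (μH[(Module.finrank ℝ (Eucl n × ℝ) : ℝ)] : Measure (Eucl n × ℝ)) (range Φ) = 0 := by
      rw [hf]; exact_mod_cast hnull
    have : (volume : Measure (Eucl n × ℝ)).IsAddHaarMeasure := by
      rw [Measure.volume_eq_prod]; infer_instance
    exact (Measure.absolutelyContinuous_isAddHaarMeasure volume _) hh
  have hae : ∀ᵐ p : Eucl n × ℝ, p ∉ range Φ := measure_eq_zero_iff_ae_notMem.1 hvol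
  have hae2 := Measure.ae_ae_of_ae_prod hae
  filter_upwards [hae2] with a ha
  filter_upwards [ha] with l hl x hx hd
  apply hl
  have hqd : DifferentiableAt ℝ q x := (hq.differentiable (by norm_num)) x
  have h1 : HasFDerivAt (fun y => q y - ⟪a, y⟫)
      (fderiv ℝ q x - innerSL ℝ a) x :=
    hqd.hasFDerivAt.sub (innerSL ℝ a).hasFDerivAt
  rw [h1.fderiv, sub_eq_zero] at hd
  have h2 : gradient q x = a := by
    rw [gradient, hd]
    exact (InnerProductSpace.toDual ℝ (Eucl n)).symm_apply_apply a
  exact ⟨x, by simp only [hΦ, h2, hx]⟩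

theorem HasFDerivAt.eventually_lt_of_lt {E : Type*} [NormedAddCommGroup E] [NormedSpace ℝ E]
    {f : E → ℝ} {f' : E →L[ℝ] ℝ} {x v : E} {c : ℝ} (hf : HasFDerivAt f f' x) (hc : c < f' v) :
    ∀ᶠ t in 𝓝[>] (0 : ℝ), f x + c * t < f (x + t • v) := by
  have h := (hf.hasLineDerivAt v).tendsto_slope_zero_right
  have h1 := h.eventually (lt_mem_nhds hc)
  filter_upwards [h1, self_mem_nhdsWithin] with t ht ht0
  have ht0' : (0 : ℝ) < t := ht0
  simp only [smul_eq_mul] at ht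
  rw [lt_inv_mul_iff₀ ht0'] at ht
  linarith

theorem tendsto_add_smul_nhdsWithin {E : Type*} [NormedAddCommGroup E] [NormedSpace ℝ E]
    (x v : E) : Tendsto (fun t : ℝ => x + t • v) (𝓝[>] 0) (𝓝 x) := by
  have : Tendsto (fun t : ℝ => x + t • v) (𝓝 0) (𝓝 (x + (0 : ℝ) • v)) :=
    (continuous_const.add (continuous_id.smul continuous_const)).tendsto _
  simpa using this.mono_left nhdsWithin_le_nhds

/-- Two defining functions of the same set have differentials that are positive in the same
directions. -/
theorem fderiv_pos_of_fderiv_pos {E : Type*} [NormedAddCommGroup E] [NormedSpace ℝ E]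
    {A B : E → ℝ} {A' B' : E →L[ℝ] ℝ} {x v : E} (hA : HasFDerivAt A A' x) (hB : HasFDerivAt B B' x)
    (hA0 : A x = 0) (hB0 : B x = 0) (hB' : B' ≠ 0) (hAB : ∀ᶠ y in 𝓝 x, B y ≤ 0 → A y ≤ 0)
    (hv : 0 < A' v) : 0 < B' v := by
  have key : ∀ w, 0 < A' w → 0 ≤ B' w := by
    intro w hw
    by_contra! hneg
    have h1 := hA.eventually_lt_of_lt (c := 0) hw
    have h2 := hB.neg.eventually_lt_of_lt (v := w) (c := 0) (by simpa using hneg)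
    have h3 := (tendsto_add_smul_nhdsWithin x w).eventually hAB
    obtain ⟨t, h1, h2, h3⟩ := (h1.and (h2.and h3)).exists
    simp only [hA0, hB0, Pi.neg_apply, zero_mul, add_zero, neg_zero] at h1 h2
    linarith [h3 (by linarith)]
  obtain ⟨w, hw⟩ : ∃ w, B' w < 0 := by
    by_contra! h
    apply hB'
    ext w
    have := h (-w)
    simp only [map_neg] at this
    simpa using le_antisymm (by linarith) (h w)
  obtain ⟨s, hs0, hs⟩ : ∃ s : ℝ, 0 < s ∧ 0 < A' (v + s • w) := by
    have hcont : Tendsto (fun s : ℝ => A' (v + s • w)) (𝓝[>] 0) (𝓝 (A' v)) :=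
      (A'.continuous.tendsto v).comp (tendsto_add_smul_nhdsWithin v w)
    obtain ⟨s, hs, hs'⟩ := ((hcont.eventually (lt_mem_nhds hv)).and self_mem_nhdsWithin).exists
    exact ⟨s, hs', hs⟩
  have := key _ hs
  simp only [map_add, map_smul, smul_eq_mul] at this
  nlinarith

theorem HasC1Boundary.isClosed {n : ℕ} {G : Set (Eucl n)} (hG : HasC1Boundary G) : IsClosed G := by
  apply isClosed_of_closure_subset
  intro x hx
  by_contra hxG
  obtain ⟨U, f, hU, hxU, hf, -, hEU⟩ := hG x ⟨hx, fun h => hxG (interior_subset h)⟩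
  have hfx : 0 < f x := by
    by_contra! h
    have : x ∈ G ∩ U := by rw [hEU]; exact ⟨hxU, h⟩
    exact hxG this.1
  have hV : IsOpen (U ∩ {y | 0 < f y}) := hU.inter (isOpen_lt continuous_const hf.continuous)
  obtain ⟨y, ⟨hyU, hy⟩, hyG⟩ := mem_closure_iff.1 hx _ hV ⟨hxU, hfx⟩
  have : y ∈ G ∩ U := ⟨hyG, hyU⟩
  rw [hEU] at this
  have h1 : 0 < f y := hy
  linarith [this.2]

/-- A set with `C¹` boundary is globally the sublevel set of a `C¹` function which is regular
on its zero set. -/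
theorem HasC1Boundary.exists_global {n : ℕ} {G : Set (Eucl n)} (hG : HasC1Boundary G) :
    ∃ f : Eucl n → ℝ, ContDiff ℝ 1 f ∧ (∀ x, x ∈ G ↔ f x ≤ 0) ∧
      ∀ x, f x = 0 → fderiv ℝ f x ≠ 0 := by
  have hcl := hG.isClosed
  have hloc : ∀ x : Eucl n, ∃ (U : Set (Eucl n)) (h : Eucl n → ℝ), IsOpen U ∧ x ∈ U ∧
      ContDiff ℝ 1 h ∧ (∀ y ∈ U, y ∈ G ↔ h y ≤ 0) ∧
      (∀ y ∈ U, h y = 0 → fderiv ℝ h y ≠ 0) := by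
    intro x
    by_cases h1 : x ∈ frontier G
    · obtain ⟨U, f, hU, hxU, hf, hd, hEU⟩ := hG x h1
      refine ⟨U, f, hU, hxU, hf, fun y hy => ?_, fun y hy _ => hd y hy⟩
      constructor
      · intro hyG
        have : y ∈ G ∩ U := ⟨hyG, hy⟩
        rw [hEU] at this
        exact this.2
      · intro hfy
        have : y ∈ G ∩ U := by rw [hEU]; exact ⟨hy, hfy⟩
        exact this.1
    by_cases h2 : x ∈ G
    · have h3 : x ∈ interior G := by
        by_contra h
        exact h1 ⟨subset_closure h2, h⟩
      refine ⟨interior G, fun _ => -1, isOpen_interior, h3, contDiff_const, fun y hy => ?_,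
        fun y _ h => by norm_num at h⟩
      simp [interior_subset hy]
    · refine ⟨Gᶜ, fun _ => 1, hcl.isOpen_compl, h2, contDiff_const, fun y hy => ?_,
        fun y _ h => by norm_num at h⟩
      have : y ∉ G := hy
      simp only [this, false_iff]
      norm_num
  choose U h hU hxU hh hGh hd using hloc
  obtain ⟨ρ, hρ⟩ := SmoothPartitionOfUnity.exists_isSubordinate (modelWithCornersSelf ℝ (Eucl n))
    isClosed_univ U hU (fun x _ => mem_iUnion.2 ⟨x, hxU x⟩)
  set f : Eucl n → ℝ := fun y => ∑ᶠ i, ρ i y • h i y with hf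
  have hfC : ContDiff ℝ 1 f := by
    apply ContMDiff.contDiff
    exact (ρ.contMDiff_finsum_smul (n := 1) fun i x _ => (hh i).contMDiff.contMDiffAt)
  have hact : ∀ i y, ρ i y ≠ 0 → y ∈ U i := fun i y hy => hρ i (subset_tsupport _ hy)
  have hconv : ∀ (y : Eucl n) (t : Set ℝ), Convex ℝ t → (∀ i, ρ i y ≠ 0 → h i y ∈ t) → f y ∈ t :=
    fun y t ht hi => ρ.finsum_smul_mem_convex (mem_univ y) hi ht
  have hin : ∀ y, y ∈ G → f y ≤ 0 := fun y hy =>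
    hconv y (Iic 0) (convex_Iic 0) fun i hi => (hGh i y (hact i y hi)).1 hy
  have hout : ∀ y, y ∉ G → 0 < f y := fun y hy =>
    hconv y (Ioi 0) (convex_Ioi 0) fun i hi =>
      not_le.1 fun hle => hy ((hGh i y (hact i y hi)).2 hle)
  have hiff : ∀ x, x ∈ G ↔ f x ≤ 0 := fun x =>
    ⟨hin x, fun hx => by by_contra h; linarith [hout x h]⟩
  refine ⟨f, hfC, hiff, ?_⟩
  intro y hy0 hdf
  have hyG : y ∈ G := (hiff y).2 hy0.le
  have hyfr : y ∉ interior G := by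
    intro hyi
    have hneg : ∀ i, ρ i y ≠ 0 → h i y < 0 := by
      intro i hi
      have hyU := hact i y hi
      refine lt_of_le_of_ne ((hGh i y hyU).1 hyG) fun h0 => ?_
      have hdi := hd i y hyU h0
      obtain ⟨v, hv⟩ : ∃ v, 0 < fderiv ℝ (h i) y v := by
        by_contra! hcon
        apply hdi
        ext w
        have := hcon (-w)
        simp only [map_neg] at this
        simpa using le_antisymm (hcon w) (by linarith)
      have e1 := (((hh i).differentiable (by norm_num)) y).hasFDerivAt.eventually_lt_of_lt (c := 0) hv
      have e2 := (tendsto_add_smul_nhdsWithin y v).eventually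
        ((isOpen_interior.inter (hU i)).mem_nhds ⟨hyi, hyU⟩)
      obtain ⟨t, e1, e2⟩ := (e1.and e2).exists
      have := (hGh i _ e2.2).1 (interior_subset e2.1)
      linarith
    have := hconv y (Iio 0) (convex_Iio 0) hneg
    exact absurd hy0 (ne_of_lt this)
  have hzero : ∀ i, y ∈ U i → h i y = 0 := by
    intro i hi
    refine le_antisymm ((hGh i y hi).1 hyG) (not_lt.1 fun hlt => hyfr ?_)
    refine mem_interior.2 ⟨U i ∩ {z | h i z < 0}, fun z hz => (hGh i z hz.1).2 (le_of_lt hz.2),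
      (hU i).inter (isOpen_lt (hh i).continuous continuous_const), hi, hlt⟩
  obtain ⟨i₀, hi₀⟩ := ρ.exists_pos_of_mem (mem_univ y)
  have hyU₀ := hact i₀ y hi₀.ne'
  obtain ⟨v, hv⟩ : ∃ v, 0 < fderiv ℝ (h i₀) y v := by
    by_contra! hcon
    apply hd i₀ y hyU₀ (hzero i₀ hyU₀)
    ext w
    have := hcon (-w)
    simp only [map_neg] at this
    simpa using le_antisymm (hcon w) (by linarith)
  have hder : ∀ i, HasFDerivAt (h i) (fderiv ℝ (h i) y) y := fun i =>
    (((hh i).differentiable (by norm_num)) y).hasFDerivAt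
  have hposv : ∀ i ∈ ρ.fintsupport y, 0 < fderiv ℝ (h i) y v := by
    intro i hi
    have hyi : y ∈ U i := hρ i ((ρ.mem_fintsupport_iff y i).1 hi)
    refine fderiv_pos_of_fderiv_pos (hder i₀) (hder i) (hzero _ hyU₀) (hzero _ hyi)
      (hd i y hyi (hzero i hyi)) ?_ hv
    filter_upwards [(hU i).mem_nhds hyi, (hU i₀).mem_nhds hyU₀] with z hz hz₀ hle
    exact (hGh i₀ z hz₀).1 ((hGh i z hz).2 hle)
  obtain ⟨c, hc0, hc⟩ : ∃ c : ℝ, 0 < c ∧ ∀ i ∈ ρ.fintsupport y, c < fderiv ℝ (h i) y v := by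
    have h1 : ∀ᶠ c in 𝓝[>] (0 : ℝ), ∀ i ∈ ρ.fintsupport y, c < fderiv ℝ (h i) y v := by
      rw [Finset.eventually_all]
      intro i hi
      exact nhdsWithin_le_nhds (gt_mem_nhds (hposv i hi))
    obtain ⟨c, hc, hc0⟩ := (h1.and self_mem_nhdsWithin).exists
    exact ⟨c, hc0, hc⟩
  have e1 : ∀ᶠ t in 𝓝[>] (0 : ℝ), ∀ i ∈ ρ.fintsupport y, c * t < h i (y + t • v) := by
    rw [Finset.eventually_all]
    intro i hi
    have hyi : y ∈ U i := hρ i ((ρ.mem_fintsupport_iff y i).1 hi)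
    have := (hder i).eventually_lt_of_lt (hc i hi)
    simpa [hzero i hyi] using this
  have e2 := (tendsto_add_smul_nhdsWithin y v).eventually (ρ.eventually_finsupport_subset y)
  have hf' : HasFDerivAt f (0 : Eucl n →L[ℝ] ℝ) y := by
    rw [← hdf]; exact ((hfC.differentiable (by norm_num)) y).hasFDerivAt
  have e3 := hf'.neg.eventually_lt_of_lt (v := v) (c := -c) (by simpa using hc0)
  obtain ⟨t, e1, e2, e3⟩ := (e1.and (e2.and e3)).exists
  have hge : c * t ≤ f (y + t • v) := by
    refine hconv _ (Ici (c * t)) (convex_Ici _) fun i hi => ?_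
    exact (e1 i (e2 ((ρ.mem_finsupport _).2 hi))).le
  simp only [Pi.neg_apply, hy0] at e3
  linarith

theorem hausdorffMeasure_le_of_antilipschitzOn {X Y : Type*} [MetricSpace X] [MetricSpace Y]
    [MeasurableSpace X] [BorelSpace X] [MeasurableSpace Y] [BorelSpace Y] {P : X → Y} {S : Set X}
    {K : ℝ≥0} (hP : ∀ x ∈ S, ∀ y ∈ S, dist x y ≤ K * dist (P x) (P y)) {d : ℝ} (hd : 0 ≤ d) :
    μH[d] S ≤ (K : ℝ≥0∞) ^ d * μH[d] (P '' S) := by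
  rcases S.eq_empty_or_nonempty with rfl | ⟨x₀, hx₀⟩
  · simp
  have : Nonempty X := ⟨x₀⟩
  have hinv : ∀ x ∈ S, Function.invFunOn P S (P x) ∈ S ∧
      P (Function.invFunOn P S (P x)) = P x := fun x hx =>
    ⟨Function.invFunOn_mem ⟨x, hx, rfl⟩, Function.invFunOn_eq ⟨x, hx, rfl⟩⟩
  have hinv' : ∀ x ∈ S, Function.invFunOn P S (P x) = x := fun x hx => by
    have := hP _ (hinv x hx).1 x hx
    rw [(hinv x hx).2, dist_self, mul_zero] at this
    exact dist_le_zero.1 this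
  have hL : LipschitzOnWith K (Function.invFunOn P S) (P '' S) := by
    refine LipschitzOnWith.of_dist_le_mul ?_
    rintro _ ⟨x, hx, rfl⟩ _ ⟨y, hy, rfl⟩
    rw [hinv' x hx, hinv' y hy]
    exact hP x hx y hy
  refine le_trans (measure_mono ?_) (hL.hausdorffMeasure_image_le hd)
  intro x hx
  exact ⟨P x, ⟨x, hx, rfl⟩, hinv' x hx⟩

/-- Uniform regularity estimates, on a set `s`, for a `C¹` function `f` that is regular on its zero
set and for its `C¹`-small perturbations on `Z`. -/
def TubeBounds {n : ℕ} (f : Eucl n → ℝ) (Z s : Set (Eucl n)) (d : ℝ) : Prop :=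
  ∃ (C : ℝ≥0) (D η κ₀ : ℝ), 0 < D ∧ 0 < η ∧ 0 < κ₀ ∧
    (∀ κ, 0 < κ → κ ≤ κ₀ → volume {x | x ∈ s ∧ |f x| ≤ κ} ≤ C * ENNReal.ofReal κ) ∧
    (∀ κ, 0 < κ → κ ≤ κ₀ → ∀ W : Eucl n → ℝ, ContDiff ℝ 1 W → (∀ x ∈ Z, |W x - f x| ≤ κ) →
      (∀ x ∈ Z, ‖fderiv ℝ W x - fderiv ℝ f x‖ ≤ η) → ∀ S ⊆ s, (∀ x ∈ S, W x = 0) →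
      μH[d] S ≤ C * μH[d] {y | f y = 0 ∧ ∃ x ∈ S, dist y x ≤ D * κ}) ∧
    (∀ x ∈ s, |f x| ≤ κ₀ → 2 * η ≤ ‖fderiv ℝ f x‖)

theorem TubeBounds.mono {n : ℕ} {f : Eucl n → ℝ} {Z s t : Set (Eucl n)} {d : ℝ}
    (hst : s ⊆ t) (h : TubeBounds f Z t d) : TubeBounds f Z s d := by
  obtain ⟨C, D, η, κ₀, hD, hη, hκ₀, ha, hb, hc⟩ := h
  refine ⟨C, D, η, κ₀, hD, hη, hκ₀, fun κ h1 h2 => ?_, fun κ h1 h2 W h3 h4 h5 S hS => ?_,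
    fun x hx => hc x (hst hx)⟩
  · refine le_trans (measure_mono ?_) (ha κ h1 h2)
    exact fun x hx => ⟨hst hx.1, hx.2⟩
  · exact hb κ h1 h2 W h3 h4 h5 S (hS.trans hst)

theorem TubeBounds.union {n : ℕ} {f : Eucl n → ℝ} {Z s t : Set (Eucl n)} {d : ℝ}
    (hs : TubeBounds f Z s d) (ht : TubeBounds f Z t d) : TubeBounds f Z (s ∪ t) d := by
  obtain ⟨C, D, η, κ₀, hD, hη, hκ₀, ha, hb, hc⟩ := hs
  obtain ⟨C', D', η', κ₀', hD', hη', hκ₀', ha', hb', hc'⟩ := ht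
  refine ⟨C + C', max D D', min η η', min κ₀ κ₀', by positivity, by positivity, by positivity,
    fun κ h1 h2 => ?_, fun κ h1 h2 W h3 h4 h5 S hS hW => ?_, fun x hx hfx => ?_⟩
  · have e : {x | x ∈ s ∪ t ∧ |f x| ≤ κ} = {x | x ∈ s ∧ |f x| ≤ κ} ∪ {x | x ∈ t ∧ |f x| ≤ κ} := by
      ext x; simp only [mem_union, mem_ofPred_eq]; tauto
    rw [e]
    push_cast
    rw [add_mul]
    exact (measure_union_le _ _).trans (add_le_add (ha κ h1 (h2.trans (min_le_left _ _)))
      (ha' κ h1 (h2.trans (min_le_right _ _))))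
  · have e : S = (S ∩ s) ∪ (S ∩ t) := by
      rw [← inter_union_distrib_left]; exact (inter_eq_left.2 hS).symm
    have hl := hb κ h1 (h2.trans (min_le_left _ _)) W h3 h4
      (fun x hx => (h5 x hx).trans (min_le_left _ _)) (S ∩ s) inter_subset_right
      (fun x hx => hW x hx.1)
    have hr := hb' κ h1 (h2.trans (min_le_right _ _)) W h3 h4
      (fun x hx => (h5 x hx).trans (min_le_right _ _)) (S ∩ t) inter_subset_right
      (fun x hx => hW x hx.1)
    have e1 : {y | f y = 0 ∧ ∃ x ∈ S ∩ s, dist y x ≤ D * κ} ⊆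
        {y | f y = 0 ∧ ∃ x ∈ S, dist y x ≤ max D D' * κ} := by
      rintro y ⟨h0, x, hx, hxy⟩
      exact ⟨h0, x, hx.1, hxy.trans (by gcongr; exact le_max_left _ _)⟩
    have e2 : {y | f y = 0 ∧ ∃ x ∈ S ∩ t, dist y x ≤ D' * κ} ⊆
        {y | f y = 0 ∧ ∃ x ∈ S, dist y x ≤ max D D' * κ} := by
      rintro y ⟨h0, x, hx, hxy⟩
      exact ⟨h0, x, hx.1, hxy.trans (by gcongr; exact le_max_right _ _)⟩
    calc μH[d] S ≤ μH[d] (S ∩ s) + μH[d] (S ∩ t) := by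
          conv_lhs => rw [e]
          exact measure_union_le _ _
      _ ≤ _ := by
          push_cast
          rw [add_mul]
          exact add_le_add (hl.trans (by gcongr)) (hr.trans (by gcongr))
  · rcases hx with hx | hx
    · exact le_trans (by gcongr; exact min_le_left _ _) (hc x hx (hfx.trans (min_le_left _ _)))
    · exact le_trans (by gcongr; exact min_le_right _ _) (hc' x hx (hfx.trans (min_le_right _ _)))

theorem TubeBounds.empty {n : ℕ} (f : Eucl n → ℝ) (Z : Set (Eucl n)) (d : ℝ) :
    TubeBounds f Z ∅ d := by
  refine ⟨0, 1, 1, 1, one_pos, one_pos, one_pos, fun κ _ _ => by simp, ?_, fun x hx => hx.elim⟩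
  intro κ _ _ W _ _ _ S hS _
  rw [subset_empty_iff.1 hS]; simp

/-- If `W` is `C¹`-close to a linear form along `v` on a ball, it grows along `v`. -/
theorem abs_sub_sub_le_of_fderiv_close {n : ℕ} {W : Eucl n → ℝ} (hW : ContDiff ℝ 1 W)
    {ℓ : Eucl n →L[ℝ] ℝ} {z : Eucl n} {r c : ℝ} (h : ∀ x ∈ ball z r, ‖fderiv ℝ W x - ℓ‖ ≤ c)
    {x y : Eucl n} (hx : x ∈ ball z r) (hy : y ∈ ball z r) :
    |W y - W x - ℓ (y - x)| ≤ c * ‖y - x‖ := by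
  have := (convex_ball z r).norm_image_sub_le_of_norm_fderiv_le' (𝕜 := ℝ) (f := W) (φ := ℓ)
    (fun x _ => (hW.differentiable (by norm_num)) x) h hx hy
  simpa [Real.norm_eq_abs] using this

theorem volume_tube_le {n : ℕ} {f : Eucl n → ℝ} (hf : Continuous f) {z v : Eucl n} {r : ℝ}
    (hr : 0 < r) (hv : 0 < ‖v‖)
    (hgrow : ∀ x ∈ ball z (2 * r), ∀ t : ℝ, 0 ≤ t → x + t • v ∈ ball z (2 * r) →
      f x + 3 / 4 * t ≤ f (x + t • v)) {κ : ℝ} (hκ : 0 < κ) (hκr : κ * (4 * ‖v‖) ≤ r) :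
    volume {x | x ∈ ball z r ∧ |f x| ≤ κ} ≤
      ENNReal.ofReal (8 * ‖v‖ / r) * volume (ball z (2 * r)) * ENNReal.ofReal κ := by
  set T : Set (Eucl n) := {x | x ∈ ball z r ∧ |f x| ≤ κ} with hT
  set N : ℕ := ⌊r / (κ * (4 * ‖v‖))⌋₊ with hN
  have hden : 0 < κ * (4 * ‖v‖) := by positivity
  have hN1 : (N : ℝ) * (κ * (4 * ‖v‖)) ≤ r := by
    rw [← le_div_iff₀ hden]; exact Nat.floor_le (by positivity)
  have hN2 : r ≤ (N : ℝ) * (κ * (8 * ‖v‖)) := by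
    have h1 : r / (κ * (4 * ‖v‖)) < N + 1 := Nat.lt_floor_add_one _
    have h2 : 1 ≤ N := by
      rw [hN, Nat.one_le_floor_iff, le_div_iff₀ hden]; linarith
    have h3 : (1 : ℝ) ≤ N := by exact_mod_cast h2
    rw [div_lt_iff₀ hden] at h1
    nlinarith
  have hTm : MeasurableSet T :=
    isOpen_ball.measurableSet.inter (isClosed_le hf.abs continuous_const).measurableSet
  set Tj : ℕ → Set (Eucl n) := fun j => (fun x => x + (-((j * (4 * κ)) • v))) ⁻¹' T with hTj
  have hmem : ∀ j x, x ∈ Tj j → ∃ y ∈ T, x = y + ((j : ℝ) * (4 * κ)) • v := by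
    intro j x hx
    exact ⟨_, hx, by simp⟩
  have hball : ∀ j < N, ∀ y ∈ T, y + ((j : ℝ) * (4 * κ)) • v ∈ ball z (2 * r) := by
    intro j hj y hy
    have h1 : dist y z < r := hy.1
    have h2 : ‖((j : ℝ) * (4 * κ)) • v‖ ≤ r := by
      rw [norm_smul, Real.norm_of_nonneg (by positivity)]
      have : (j : ℝ) ≤ N := by exact_mod_cast hj.le
      calc (j : ℝ) * (4 * κ) * ‖v‖ = j * (κ * (4 * ‖v‖)) := by ring
        _ ≤ N * (κ * (4 * ‖v‖)) := by gcongr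
        _ ≤ r := hN1
    rw [mem_ball, dist_eq_norm] at *
    calc ‖y + ((j : ℝ) * (4 * κ)) • v - z‖ = ‖(y - z) + ((j : ℝ) * (4 * κ)) • v‖ := by
          congr 1; abel
      _ ≤ ‖y - z‖ + ‖((j : ℝ) * (4 * κ)) • v‖ := norm_add_le _ _
      _ < 2 * r := by linarith
  have hlt : ∀ i j : ℕ, i < j → j < N → Disjoint (Tj i) (Tj j) := by
    intro i j hij hj
    rw [Set.disjoint_left]
    intro x hxi hxj
    obtain ⟨y, hy, rfl⟩ := hmem i x hxi
    obtain ⟨w, hw, hwy⟩ := hmem j _ hxj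
    have hy' : y = w + (((j : ℝ) - i) * (4 * κ)) • v := by
      have : y = w + ((j : ℝ) * (4 * κ)) • v - ((i : ℝ) * (4 * κ)) • v := by
        rw [← hwy]; abel
      rw [this, sub_mul, sub_smul]; abel
    have hji : (1 : ℝ) ≤ (j : ℝ) - i := by
      have : (i : ℝ) + 1 ≤ j := by exact_mod_cast hij
      linarith
    have hsub : ball z r ⊆ ball z (2 * r) := ball_subset_ball (by linarith)
    have := hgrow w (hsub hw.1) (((j : ℝ) - i) * (4 * κ)) (by nlinarith) (by
      rw [← hy']; exact hsub hy.1)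
    rw [← hy'] at this
    have h1 := (abs_le.1 hy.2).2
    have h2 := (abs_le.1 hw.2).1
    nlinarith
  have hdisj : (↑(Finset.range N) : Set ℕ).PairwiseDisjoint Tj := by
    intro i hi j hj hij
    simp only [Finset.coe_range, mem_Iio] at hi hj
    rcases lt_or_gt_of_ne hij with h | h
    · exact hlt i j h hj
    · exact (hlt j i h hi).symm
  have hvolj : ∀ j, volume (Tj j) = volume T := fun j => measure_preimage_add_right _ _ _
  have hsum : (N : ℝ≥0∞) * volume T ≤ volume (ball z (2 * r)) := by
    have h1 := measure_biUnion_finset (μ := volume) hdisj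
      (fun j _ => (measurable_add_const _) hTm)
    simp only [hvolj, Finset.sum_const, Finset.card_range, nsmul_eq_mul] at h1
    rw [← h1]
    refine measure_mono (iUnion₂_subset fun j hj x hx => ?_)
    obtain ⟨y, hy, rfl⟩ := hmem j x hx
    exact hball j (Finset.mem_range.1 hj) y hy
  have hone : (1 : ℝ≥0∞) ≤ ENNReal.ofReal (8 * ‖v‖ / r) * ENNReal.ofReal κ * N := by
    rw [← ENNReal.ofReal_natCast, ← ENNReal.ofReal_mul (by positivity),
      ← ENNReal.ofReal_mul (by positivity), ENNReal.one_le_ofReal]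
    rw [div_mul_eq_mul_div, div_mul_eq_mul_div, le_div_iff₀ hr]
    linarith
  calc volume T = 1 * volume T := (one_mul _).symm
    _ ≤ ENNReal.ofReal (8 * ‖v‖ / r) * ENNReal.ofReal κ * N * volume T := by gcongr
    _ = ENNReal.ofReal (8 * ‖v‖ / r) * ENNReal.ofReal κ * (N * volume T) := by ring
    _ ≤ ENNReal.ofReal (8 * ‖v‖ / r) * ENNReal.ofReal κ * volume (ball z (2 * r)) := by gcongr
    _ = _ := by ring

theorem tubeBounds_of_ne_zero {n : ℕ} {f : Eucl n → ℝ} (hf : Continuous f) {Z : Set (Eucl n)}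
    {d : ℝ} {z : Eucl n} (hZ : Z ∈ 𝓝 z) (hz : f z ≠ 0) :
    ∃ t ∈ 𝓝 z, TubeBounds f Z t d := by
  have hpos : 0 < |f z| := abs_pos.2 hz
  have hev : ∀ᶠ x in 𝓝 z, |f z| / 2 < |f x| :=
    (hf.abs.tendsto z).eventually (lt_mem_nhds (by linarith))
  refine ⟨_, inter_mem hev hZ, 0, 1, 1, |f z| / 4, one_pos, one_pos, by linarith, ?_, ?_, ?_⟩
  · intro κ _ h
    have : {x | x ∈ {x | |f z| / 2 < |f x|} ∩ Z ∧ |f x| ≤ κ} = ∅ := by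
      ext x
      simp only [mem_ofPred_eq, mem_empty_iff_false, iff_false, not_and, not_le, mem_inter_iff]
      intro hx
      linarith [hx.1]
    rw [this, measure_empty]
    exact zero_le
  · intro κ _ h W _ hW _ S hS hS0
    have : S = ∅ := by
      ext x
      simp only [mem_empty_iff_false, iff_false]
      intro hx
      have h1 := hW x (hS hx).2
      have h2 : |f z| / 2 < |f x| := (hS hx).1
      rw [hS0 x hx, zero_sub, abs_neg] at h1
      linarith
    simp [this]
  · intro x hx h
    have h2 : |f z| / 2 < |f x| := hx.1
    linarith

theorem tubeBounds_of_eq_zero {n : ℕ} {f : Eucl n → ℝ} (hf : ContDiff ℝ 1 f) {Z : Set (Eucl n)}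
    {d : ℝ} (hd : 0 ≤ d) {z : Eucl n} (hZ : Z ∈ 𝓝 z) (hz : fderiv ℝ f z ≠ 0) :
    ∃ t ∈ 𝓝 z, TubeBounds f Z t d := by
  set ℓ := fderiv ℝ f z with hℓ
  obtain ⟨v, hv⟩ : ∃ v, ℓ v = 1 := by
    obtain ⟨w, hw⟩ : ∃ w, ℓ w ≠ 0 := by
      by_contra! h
      exact hz (ContinuousLinearMap.ext h)
    exact ⟨(ℓ w)⁻¹ • w, by simp [hw]⟩
  have hv0 : 0 < ‖v‖ := norm_pos_iff.2 fun h => by simp [h] at hv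
  have hcont : Continuous (fderiv ℝ f) := hf.continuous_fderiv (by norm_num)
  have hev : ∀ᶠ x in 𝓝 z, ‖fderiv ℝ f x - ℓ‖ < 1 / (4 * ‖v‖) := by
    have : Tendsto (fun x => ‖fderiv ℝ f x - ℓ‖) (𝓝 z) (𝓝 ‖fderiv ℝ f z - ℓ‖) :=
      ((hcont.sub continuous_const).norm).tendsto z
    rw [hℓ, sub_self, norm_zero] at this
    exact this.eventually (gt_mem_nhds (by positivity))
  obtain ⟨r', hr', hball⟩ := Metric.mem_nhds_iff.1 (inter_mem hev hZ)
  set r := r' / 2 with hrdef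
  have hr : 0 < r := by positivity
  have h2r : 2 * r = r' := by rw [hrdef]; ring
  rw [← h2r] at hball
  have hfb : ∀ x ∈ ball z (2 * r), ‖fderiv ℝ f x - ℓ‖ ≤ 1 / (4 * ‖v‖) := fun x hx =>
    le_of_lt (hball hx).1
  have hgrow : ∀ x ∈ ball z (2 * r), ∀ t : ℝ, 0 ≤ t → x + t • v ∈ ball z (2 * r) →
      f x + 3 / 4 * t ≤ f (x + t • v) := by
    intro x hx t ht hxt
    have h1 := abs_sub_sub_le_of_fderiv_close hf hfb hx hxt
    rw [add_sub_cancel_left, map_smul, hv, norm_smul, Real.norm_of_nonneg ht] at h1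
    have h2 : 1 / (4 * ‖v‖) * (t * ‖v‖) = t / 4 := by field_simp
    rw [h2, smul_eq_mul, mul_one] at h1
    linarith [(abs_le.1 h1).1]
  set P : Eucl n →L[ℝ] Eucl n := ContinuousLinearMap.id ℝ (Eucl n) - ℓ.smulRight v with hP
  have hPapp : ∀ w, P w = w - ℓ w • v := fun w => by simp [hP]
  set C₁ : ℝ≥0 := (ENNReal.ofReal (8 * ‖v‖ / r) * volume (ball z (2 * r))).toNNReal with hC₁
  set C₂ : ℝ≥0 := (2 : ℝ≥0) ^ d * ‖P‖₊ ^ d with hC₂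
  refine ⟨ball z r, ball_mem_nhds z hr, C₁ + C₂, 2 * ‖v‖, 1 / (4 * ‖v‖), r / (4 * ‖v‖),
    by positivity, by positivity, by positivity, ?_, ?_, ?_⟩
  · intro κ hκ hκr
    rw [le_div_iff₀ (by positivity)] at hκr
    refine (volume_tube_le hf.continuous hr hv0 hgrow hκ hκr).trans ?_
    gcongr
    rw [ENNReal.coe_add, hC₁, ENNReal.coe_toNNReal]
    · exact le_self_add
    · exact ENNReal.mul_ne_top ENNReal.ofReal_ne_top measure_ball_lt_top.ne
  · intro κ hκ hκr W hW hWf hWd S hS hS0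
    rw [le_div_iff₀ (by positivity)] at hκr
    have hsub : ball z r ⊆ ball z (2 * r) := ball_subset_ball (by linarith)
    have hWb : ∀ x ∈ ball z (2 * r), ‖fderiv ℝ W x - ℓ‖ ≤ 1 / (2 * ‖v‖) := by
      intro x hx
      calc ‖fderiv ℝ W x - ℓ‖ ≤ ‖fderiv ℝ W x - fderiv ℝ f x‖ + ‖fderiv ℝ f x - ℓ‖ :=
            norm_sub_le_norm_sub_add_norm_sub _ _ _
        _ ≤ 1 / (4 * ‖v‖) + 1 / (4 * ‖v‖) := add_le_add (hWd x (hball hx).2) (hfb x hx)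
        _ = 1 / (2 * ‖v‖) := by field_simp; norm_num
    have hanti : ∀ x ∈ S, ∀ y ∈ S, dist x y ≤ (2 : ℝ≥0) * dist (P x) (P y) := by
      intro x hx y hy
      have h1 := abs_sub_sub_le_of_fderiv_close hW hWb (hsub (hS hx)) (hsub (hS hy))
      rw [hS0 x hx, hS0 y hy, sub_zero, zero_sub, abs_neg] at h1
      have h2 : |ℓ (y - x)| * ‖v‖ ≤ ‖y - x‖ / 2 := by
        calc |ℓ (y - x)| * ‖v‖ ≤ 1 / (2 * ‖v‖) * ‖y - x‖ * ‖v‖ := by gcongr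
          _ = ‖y - x‖ / 2 := by field_simp
      have h3 : ‖y - x‖ ≤ ‖P (y - x)‖ + ‖ℓ (y - x) • v‖ := by
        have : y - x = P (y - x) + ℓ (y - x) • v := by rw [hPapp]; abel
        conv_lhs => rw [this]
        exact norm_add_le _ _
      rw [norm_smul, Real.norm_eq_abs] at h3
      rw [dist_comm, dist_comm (P x), dist_eq_norm, dist_eq_norm, ← map_sub, NNReal.coe_ofNat]
      linarith
    have himg : P '' S ⊆ P '' {y | f y = 0 ∧ ∃ x ∈ S, dist y x ≤ 2 * ‖v‖ * κ} := by
      rintro _ ⟨x, hx, rfl⟩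
      have hxb := hS hx
      have hfx : |f x| ≤ κ := by
        have := hWf x (hball (hsub hxb)).2
        rwa [hS0 x hx, zero_sub, abs_neg] at this
      have hin : ∀ t ∈ Icc (-(2 * κ)) (2 * κ), x + t • v ∈ ball z (2 * r) := by
        intro t ht
        have h1 : dist x z < r := hxb
        have h2 : ‖t • v‖ ≤ r / 2 := by
          rw [norm_smul, Real.norm_eq_abs]
          have : |t| ≤ 2 * κ := abs_le.2 ht
          nlinarith
        rw [mem_ball, dist_eq_norm] at *
        calc ‖x + t • v - z‖ = ‖(x - z) + t • v‖ := by congr 1; abel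
          _ ≤ ‖x - z‖ + ‖t • v‖ := norm_add_le _ _
          _ < 2 * r := by linarith
      have hhi : 0 ≤ f (x + (2 * κ) • v) := by
        have := hgrow x (hsub hxb) (2 * κ) (by linarith) (hin _ ⟨by linarith, le_rfl⟩)
        linarith [(abs_le.1 hfx).1]
      have hlo : f (x + (-(2 * κ)) • v) ≤ 0 := by
        have := hgrow (x + (-(2 * κ)) • v) (hin _ ⟨le_rfl, by linarith⟩) (2 * κ) (by linarith)
          (by rw [neg_smul, neg_add_cancel_right]; exact hsub hxb)
        rw [neg_smul, neg_add_cancel_right] at this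
        rw [neg_smul]
        linarith [(abs_le.1 hfx).2]
      have hc : ContinuousOn (fun t : ℝ => f (x + t • v)) (Icc (-(2 * κ)) (2 * κ)) :=
        (hf.continuous.comp (by fun_prop)).continuousOn
      obtain ⟨t, ht, ht0⟩ := intermediate_value_Icc (by linarith) hc ⟨hlo, hhi⟩
      refine ⟨x + t • v, ⟨ht0, x, hx, ?_⟩, ?_⟩
      · rw [dist_eq_norm, add_sub_cancel_left, norm_smul, Real.norm_eq_abs]
        have : |t| ≤ 2 * κ := abs_le.2 ht
        nlinarith
      · rw [map_add, map_smul, hPapp v, hv, one_smul, sub_self, smul_zero, add_zero]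
    calc μH[d] S ≤ ((2 : ℝ≥0) : ℝ≥0∞) ^ d * μH[d] (P '' S) :=
          hausdorffMeasure_le_of_antilipschitzOn hanti hd
      _ ≤ ((2 : ℝ≥0) : ℝ≥0∞) ^ d *
            μH[d] (P '' {y | f y = 0 ∧ ∃ x ∈ S, dist y x ≤ 2 * ‖v‖ * κ}) := by gcongr
      _ ≤ ((2 : ℝ≥0) : ℝ≥0∞) ^ d * ((‖P‖₊ : ℝ≥0∞) ^ d *
            μH[d] {y | f y = 0 ∧ ∃ x ∈ S, dist y x ≤ 2 * ‖v‖ * κ}) := by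
          gcongr
          exact P.lipschitz.hausdorffMeasure_image_le hd _
      _ = (C₂ : ℝ≥0∞) * μH[d] {y | f y = 0 ∧ ∃ x ∈ S, dist y x ≤ 2 * ‖v‖ * κ} := by
          rw [hC₂, ENNReal.coe_mul, ENNReal.coe_rpow_of_nonneg _ hd,
            ENNReal.coe_rpow_of_nonneg _ hd]
          exact (mul_assoc _ _ _).symm
      _ ≤ _ := by
          gcongr
          exact le_add_self
  · intro x hx _
    have h1 := hfb x (ball_subset_ball (by linarith) hx)
    have h2 : |(fderiv ℝ f x - ℓ) v| ≤ 1 / (4 * ‖v‖) * ‖v‖ := by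
      rw [← Real.norm_eq_abs]
      exact (ContinuousLinearMap.le_opNorm _ _).trans (by gcongr)
    have h3 : |fderiv ℝ f x v| ≤ ‖fderiv ℝ f x‖ * ‖v‖ := by
      rw [← Real.norm_eq_abs]; exact ContinuousLinearMap.le_opNorm _ _
    have h4 : 1 / (4 * ‖v‖) * ‖v‖ = 1 / 4 := by field_simp
    rw [h4, _root_.sub_apply, hv] at h2
    have h5 : 3 / 4 ≤ ‖fderiv ℝ f x‖ * ‖v‖ := by
      have := (abs_le.1 h2).1
      have := le_abs_self (fderiv ℝ f x v)
      linarith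
    have h6 : 2 * (1 / (4 * ‖v‖)) * ‖v‖ = 1 / 2 := by field_simp; norm_num
    by_contra! hcon
    have := mul_lt_mul_of_pos_right hcon hv0
    linarith

/-- A `C¹` function that is regular on its zero set satisfies uniform tube estimates on
compact sets. -/
theorem tubeBounds_of_isCompact {n : ℕ} {f : Eucl n → ℝ} (hf : ContDiff ℝ 1 f)
    (hreg : ∀ x, f x = 0 → fderiv ℝ f x ≠ 0) {K Z : Set (Eucl n)} (hK : IsCompact K)
    (hKZ : ∀ x ∈ K, Z ∈ 𝓝 x) {d : ℝ} (hd : 0 ≤ d) : TubeBounds f Z K d := by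
  refine hK.induction_on (p := fun s => TubeBounds f Z s d) (TubeBounds.empty f Z d)
    (fun s t hst h => h.mono hst) (fun s t => TubeBounds.union) fun x hx => ?_
  by_cases h : f x = 0
  · obtain ⟨t, ht, hT⟩ := tubeBounds_of_eq_zero hf hd (hKZ x hx) (hreg x h)
    exact ⟨t, mem_nhdsWithin_of_mem_nhds ht, hT⟩
  · obtain ⟨t, ht, hT⟩ := tubeBounds_of_ne_zero hf.continuous (d := d) (hKZ x hx) h
    exact ⟨t, mem_nhdsWithin_of_mem_nhds ht, hT⟩

theorem exists_contDiff_approx_of_hasCompactSupport {n : ℕ} {f : Eucl n → ℝ}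
    (hf : ContDiff ℝ 1 f) (hc : HasCompactSupport f) {ε : ℝ} (hε : 0 < ε) :
    ∃ g : Eucl n → ℝ, ContDiff ℝ 2 g ∧ ∀ x, |g x - f x| ≤ ε ∧
      ‖fderiv ℝ g x - fderiv ℝ f x‖ ≤ ε := by
  have hdf : Continuous (fderiv ℝ f) := hf.continuous_fderiv (by norm_num)
  have hu1 : UniformContinuous f := hc.uniformContinuous_of_continuous hf.continuous
  have hu2 : UniformContinuous (fderiv ℝ f) :=
    (hc.fderiv (𝕜 := ℝ)).uniformContinuous_of_continuous hdf
  obtain ⟨δ₁, hδ₁, h1⟩ := Metric.uniformContinuous_iff.1 hu1 ε hε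
  obtain ⟨δ₂, hδ₂, h2⟩ := Metric.uniformContinuous_iff.1 hu2 ε hε
  set δ := min δ₁ δ₂ with hδ
  have hδ0 : 0 < δ := lt_min hδ₁ hδ₂
  let φ : ContDiffBump (0 : Eucl n) := ⟨δ / 2, δ, by positivity, by linarith⟩
  have hli : LocallyIntegrable (φ.normed volume) (volume : Measure (Eucl n)) :=
    (φ.continuous_normed).locallyIntegrable
  refine ⟨convolution (φ.normed volume) f (ContinuousLinearMap.lsmul ℝ ℝ) volume, ?_, fun x =>
    ⟨?_, ?_⟩⟩
  · exact (φ.hasCompactSupport_normed).contDiff_convolution_left _ (φ.contDiff_normed)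
      (hf.continuous.locallyIntegrable)
  · have := φ.dist_normed_convolution_le (μ := volume) (g := f) (x₀ := x) (ε := ε)
      hf.continuous.aestronglyMeasurable
      (fun y hy => (h1 (lt_of_lt_of_le hy (min_le_left _ _))).le)
    rwa [Real.dist_eq] at this
  · have hd := hc.hasFDerivAt_convolution_right (ContinuousLinearMap.lsmul ℝ ℝ) hli hf x
    rw [hd.fderiv]
    have := φ.dist_normed_convolution_le (μ := volume) (g := fderiv ℝ f) (x₀ := x) (ε := ε)
      hdf.aestronglyMeasurable
      (fun y hy => (h2 (lt_of_lt_of_le hy (min_le_right _ _))).le)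
    rw [dist_eq_norm] at this
    exact this

/-- `C¹` approximation by `C²` functions on bounded sets. -/
theorem exists_contDiff_approx {n : ℕ} {f : Eucl n → ℝ} (hf : ContDiff ℝ 1 f) {r ε : ℝ}
    (hr : 0 < r) (hε : 0 < ε) :
    ∃ g : Eucl n → ℝ, ContDiff ℝ 2 g ∧ ∀ x ∈ ball (0 : Eucl n) r, |g x - f x| ≤ ε ∧
      ‖fderiv ℝ g x - fderiv ℝ f x‖ ≤ ε := by
  let ψ : ContDiffBump (0 : Eucl n) := ⟨r, r + 1, hr, by linarith⟩
  obtain ⟨g, hg, hgf⟩ := exists_contDiff_approx_of_hasCompactSupport (f := fun x => ψ x * f x)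
    (ψ.contDiff.mul hf) (ψ.hasCompactSupport.mul_right) hε
  refine ⟨g, hg, fun x hx => ?_⟩
  have hev : (fun x => ψ x * f x) =ᶠ[𝓝 x] f := by
    filter_upwards [isOpen_ball.mem_nhds hx] with y hy
    rw [ψ.one_of_mem_closedBall (ball_subset_closedBall hy), one_mul]
  have := hgf x
  rwa [hev.fderiv_eq, hev.eq_of_nhds] at this

theorem exists_lipschitzWith_of_abs_deriv_le {f : ℝ → ℝ} (hf : ContDiff ℝ 1 f) {a b : ℝ}
    (h : ∀ t ∉ Icc a b, |deriv f t| ≤ 1) : ∃ K : ℝ≥0, LipschitzWith K f := by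
  obtain ⟨M, hM⟩ := isCompact_Icc (a := a) (b := b) |>.exists_bound_of_continuousOn
    (hf.continuous_deriv (by norm_num)).continuousOn
  refine ⟨(max M 1).toNNReal, lipschitzWith_of_nnnorm_deriv_le
    (hf.differentiable (by norm_num)) fun t => ?_⟩
  rw [← NNReal.coe_le_coe, coe_nnnorm, Real.coe_toNNReal _ (le_max_of_le_right zero_le_one)]
  by_cases ht : t ∈ Icc a b
  · exact (hM t ht).trans (le_max_left _ _)
  · exact (h t ht).trans (le_max_right _ _)

theorem exists_lipschitzWith_smoothTransition :
    ∃ K : ℝ≥0, LipschitzWith K Real.smoothTransition := by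
  refine exists_lipschitzWith_of_abs_deriv_le Real.smoothTransition.contDiff (a := 0) (b := 1)
    fun t ht => ?_
  have : deriv Real.smoothTransition t = 0 := by
    rw [mem_Icc, not_and_or, not_le, not_le] at ht
    rcases ht with ht | ht
    · have : Real.smoothTransition =ᶠ[𝓝 t] fun _ => 0 := by
        filter_upwards [gt_mem_nhds ht] with s hs
        exact Real.smoothTransition.zero_of_nonpos hs.le
      rw [this.deriv_eq, deriv_const]
    · have : Real.smoothTransition =ᶠ[𝓝 t] fun _ => 1 := by
        filter_upwards [lt_mem_nhds ht] with s hs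
        exact Real.smoothTransition.one_of_one_le hs.le
      rw [this.deriv_eq, deriv_const]
  rw [this, abs_zero]
  exact zero_le_one

/-- A smooth Lipschitz truncation of the identity at height one. -/
theorem exists_smooth_truncation :
    ∃ (χ : ℝ → ℝ) (K : ℝ≥0), ContDiff ℝ 2 χ ∧ LipschitzWith K χ ∧ (∀ t ≤ 1 / 2, χ t = t) ∧
      (∀ t, 1 ≤ t → χ t = 1) ∧ (∀ t, 1 / 2 ≤ t → 1 / 2 ≤ χ t) ∧ ∀ t, χ t ≤ 1 := by
  set σ : ℝ → ℝ := fun t => Real.smoothTransition (2 * t - 1) with hσ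
  set χ : ℝ → ℝ := fun t => (t - 1) * (1 - σ t) + 1 with hχ
  have hσ0 : ∀ t, 0 ≤ σ t := fun t => Real.smoothTransition.nonneg _
  have hσ1 : ∀ t, σ t ≤ 1 := fun t => Real.smoothTransition.le_one _
  have hlow : ∀ t ≤ 1 / 2, χ t = t := fun t ht => by
    simp only [hχ, hσ]
    rw [Real.smoothTransition.zero_of_nonpos (by linarith)]; ring
  have hhigh : ∀ t, 1 ≤ t → χ t = 1 := fun t ht => by
    simp only [hχ, hσ]
    rw [Real.smoothTransition.one_of_one_le (by linarith)]; ring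
  have hsm : ContDiff ℝ 2 χ := by
    have : ContDiff ℝ 2 σ := Real.smoothTransition.contDiff.comp (by fun_prop)
    fun_prop
  obtain ⟨K, hK⟩ := exists_lipschitzWith_of_abs_deriv_le (f := χ) (a := 1 / 2) (b := 1)
    (hsm.of_le (by norm_num)) fun t ht => by
      rw [mem_Icc, not_and_or, not_le, not_le] at ht
      rcases ht with ht | ht
      · have : χ =ᶠ[𝓝 t] id := by
          filter_upwards [gt_mem_nhds ht] with s hs
          exact hlow s hs.le
        rw [this.deriv_eq, deriv_id, abs_one]
      · have : χ =ᶠ[𝓝 t] fun _ => 1 := by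
          filter_upwards [lt_mem_nhds ht] with s hs
          exact hhigh s hs.le
        rw [this.deriv_eq, deriv_const, abs_zero]
        exact zero_le_one
  refine ⟨χ, K, hsm, hK, hlow, hhigh, fun t ht => ?_, fun t => ?_⟩
  · have h1 := hσ0 t
    have h2 := hσ1 t
    simp only [hχ]
    nlinarith
  · rcases le_total 1 t with h | h
    · exact (hhigh t h).le
    · have := hσ1 t
      simp only [hχ]
      nlinarith

/-- Radial cutoff functions with controlled Lipschitz constant. -/
theorem exists_radial_cutoff : ∃ K : ℝ≥0, ∀ (n : ℕ) (α β : ℝ), 0 < α → α < β →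
    ∃ p : Eucl n → ℝ, ContDiff ℝ 2 p ∧ LipschitzWith (K / (β - α).toNNReal) p ∧
      (∀ x, 0 ≤ p x) ∧ (∀ x, p x ≤ 1) ∧ (∀ x, ‖x‖ ≤ α → p x = 1) ∧
      ∀ x, β ≤ ‖x‖ → p x = 0 := by
  obtain ⟨K, hK⟩ := exists_lipschitzWith_smoothTransition
  refine ⟨2 * K, fun n α β hα hαβ => ?_⟩
  have hden : 0 < β ^ 2 - α ^ 2 := by nlinarith
  set p : Eucl n → ℝ :=
    fun x => Real.smoothTransition ((β ^ 2 - ‖x‖ ^ 2) / (β ^ 2 - α ^ 2)) with hp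
  have hzero : ∀ x, β ≤ ‖x‖ → p x = 0 := fun x hx => by
    refine Real.smoothTransition.zero_of_nonpos (div_nonpos_of_nonpos_of_nonneg ?_ hden.le)
    nlinarith
  refine ⟨p, ?_, ?_, fun x => Real.smoothTransition.nonneg _,
    fun x => Real.smoothTransition.le_one _, fun x hx => ?_, hzero⟩
  · refine Real.smoothTransition.contDiff.comp ?_
    have : ContDiff ℝ 2 fun x : Eucl n => ‖x‖ ^ 2 := contDiff_norm_sq ℝ
    fun_prop
  · have hpm : ∀ x, p x =
        Real.smoothTransition ((β ^ 2 - (min ‖x‖ β) ^ 2) / (β ^ 2 - α ^ 2)) := by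
      intro x
      rcases le_total ‖x‖ β with h | h
      · rw [min_eq_left h]
      · rw [min_eq_right h, hzero x h, sub_self, zero_div, Real.smoothTransition.zero]
    refine LipschitzWith.of_dist_le_mul fun x y => ?_
    have h1 := hK.dist_le_mul ((β ^ 2 - (min ‖x‖ β) ^ 2) / (β ^ 2 - α ^ 2))
      ((β ^ 2 - (min ‖y‖ β) ^ 2) / (β ^ 2 - α ^ 2))
    rw [← hpm, ← hpm] at h1
    refine h1.trans ?_
    have hmin : |min ‖x‖ β - min ‖y‖ β| ≤ dist x y := by
      refine (abs_min_sub_min_le_max _ _ _ _).trans ?_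
      rw [sub_self, abs_zero, max_eq_left (abs_nonneg _), dist_eq_norm]
      exact abs_norm_sub_norm_le x y
    have h0x : 0 ≤ min ‖x‖ β := le_min (norm_nonneg _) (by linarith)
    have h0y : 0 ≤ min ‖y‖ β := le_min (norm_nonneg _) (by linarith)
    have hxb : min ‖x‖ β ≤ β := min_le_right _ _
    have hyb : min ‖y‖ β ≤ β := min_le_right _ _
    have h2 : dist ((β ^ 2 - (min ‖x‖ β) ^ 2) / (β ^ 2 - α ^ 2))
        ((β ^ 2 - (min ‖y‖ β) ^ 2) / (β ^ 2 - α ^ 2)) ≤ 2 / (β - α) * dist x y := by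
      rw [Real.dist_eq, ← sub_div, abs_div, abs_of_pos hden, div_le_iff₀ hden]
      have e : β ^ 2 - min ‖x‖ β ^ 2 - (β ^ 2 - min ‖y‖ β ^ 2) =
        -((min ‖x‖ β - min ‖y‖ β) * (min ‖x‖ β + min ‖y‖ β)) := by ring
      rw [e, abs_neg, abs_mul, abs_of_nonneg (add_nonneg h0x h0y)]
      have e2 : 2 / (β - α) * dist x y * (β ^ 2 - α ^ 2) = dist x y * (2 * (β + α)) := by
        have : β - α ≠ 0 := by linarith
        field_simp; ring
      rw [e2]
      exact mul_le_mul hmin (by linarith) (by positivity) dist_nonneg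
    rw [NNReal.coe_div, Real.coe_toNNReal _ (by linarith), NNReal.coe_mul, NNReal.coe_ofNat]
    calc (K : ℝ) * _ ≤ K * (2 / (β - α) * dist x y) := by gcongr
      _ = 2 * K / (β - α) * dist x y := by ring
  · refine Real.smoothTransition.one_of_one_le ?_
    rw [le_div_iff₀ hden]
    have := norm_nonneg x
    nlinarith

theorem mem_frontier_of_fderiv_ne_zero {n : ℕ} {f : Eucl n → ℝ} {G : Set (Eucl n)}
    (hG : ∀ x, x ∈ G ↔ f x ≤ 0) {x : Eucl n} (h0 : f x = 0)
    (hd : fderiv ℝ f x ≠ 0) : x ∈ frontier G := by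
  refine ⟨subset_closure ((hG x).2 h0.le), fun hint => hd ?_⟩
  have : IsLocalMax f x := by
    filter_upwards [mem_interior_iff_mem_nhds.1 hint] with y hy
    rw [h0]
    exact (hG y).1 hy
  exact this.fderiv_eq_zero

theorem eq_zero_of_mem_frontier {n : ℕ} {F U : Set (Eucl n)} {W : Eucl n → ℝ} (hU : IsOpen U)
    (hW : Continuous W) (hF : ∀ y ∈ U, y ∈ F ↔ W y ≤ 0) {x : Eucl n} (hx : x ∈ frontier F)
    (hxU : x ∈ U) : W x = 0 := by
  rcases lt_trichotomy (W x) 0 with h | h | h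
  · refine (hx.2 (mem_interior_iff_mem_nhds.2 ?_)).elim
    filter_upwards [hU.mem_nhds hxU, (hW.tendsto x).eventually (gt_mem_nhds h)] with y hy hy'
    exact (hF y hy).2 hy'.le
  · exact h
  · obtain ⟨y, ⟨hy, hy'⟩, hyF⟩ := mem_closure_iff_nhds.1 hx.1 _
      (inter_mem (hU.mem_nhds hxU) ((hW.tendsto x).eventually (lt_mem_nhds h)))
    exact absurd ((hF y hy).1 hyF) (not_le.2 hy')

theorem hasC1Boundary_of_local {n : ℕ} {F : Set (Eucl n)}
    (h : ∀ x, ∃ (U : Set (Eucl n)) (W : Eucl n → ℝ), IsOpen U ∧ x ∈ U ∧ ContDiff ℝ 1 W ∧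
      (∀ y ∈ U, y ∈ F ↔ W y ≤ 0) ∧ ∀ y ∈ U, W y = 0 → fderiv ℝ W y ≠ 0) : HasC1Boundary F := by
  intro x hx
  obtain ⟨U, W, hU, hxU, hW, hF, hreg⟩ := h x
  have h0 := eq_zero_of_mem_frontier hU hW.continuous hF hx hxU
  have hc : Continuous (fderiv ℝ W) := hW.continuous_fderiv (by norm_num)
  refine ⟨U ∩ {y | fderiv ℝ W y ≠ 0}, W, hU.inter (isOpen_ne_fun hc continuous_const),
    ⟨hxU, hreg x hxU h0⟩, hW, fun y hy => hy.2, ?_⟩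
  ext y
  simp only [mem_inter_iff, mem_ofPred_eq]
  constructor
  · rintro ⟨h1, h2, h3⟩
    exact ⟨⟨h2, h3⟩, (hF y h2).1 h1⟩
  · rintro ⟨⟨h2, h3⟩, h1⟩
    exact ⟨(hF y h2).2 h1, h2, h3⟩

/-- A level of a Lipschitz function, avoiding a null set, whose measure is controlled by the
coarea inequality. -/
theorem exists_level_hausdorffMeasure_le (m : ℕ) : ∃ c : ℝ≥0, ∀ (q : Eucl (m + 1) → ℝ)
    (p : ℝ → Prop) (A₁ A₂ : Set (Eucl (m + 1))) (K₁ K₂ : ℝ≥0) (ε : ℝ≥0∞), (∀ᵐ l, p l) →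
    IsBounded A₁ → IsBounded A₂ → LipschitzOnWith K₁ q A₁ → LipschitzOnWith K₂ q A₂ → 0 < ε →
    ∃ l ∈ Ioo (1 / 16 : ℝ) (1 / 8), p l ∧ μH[(m : ℝ)] {x | x ∈ A₁ ∪ A₂ ∧ q x = l} ≤
      c * (K₁ * volume A₁ + K₂ * volume A₂) + ε := by
  obtain ⟨c, hc⟩ := hausdorffMeasure_eucl_eq_smul_volume (m + 1)
  refine ⟨16 * c, fun q p A₁ A₂ K₁ K₂ ε hp hb₁ hb₂ h₁ h₂ hε => ?_⟩
  by_contra! hcon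
  have hn : ((m : ℝ) + 1) = ((m + 1 : ℕ) : ℝ) := by push_cast; ring
  have hH : ∀ A : Set (Eucl (m + 1)), IsBounded A → μH[(m : ℝ) + 1] A ≠ ⊤ := fun A hA => by
    rw [hn, hc]
    exact ENNReal.mul_ne_top ENNReal.coe_ne_top hA.measure_lt_top.ne
  have hE : ∀ (A : Set (Eucl (m + 1))) (K : ℝ≥0), IsBounded A → LipschitzOnWith K q A →
      ∃ h : ℝ → ℝ≥0∞, Measurable h ∧ (∀ l, μH[(m : ℝ)] {x | x ∈ A ∧ q x = l} ≤ h l) ∧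
        ∫⁻ l, h l ≤ c * (K * volume A) := fun A K hA hK => by
    obtain ⟨h, hm, hle, hint⟩ := eilenberg_inequality hK m.cast_nonneg (hH A hA)
    refine ⟨h, hm, hle, hint.trans (le_of_eq ?_)⟩
    rw [hn, hc]; ring
  obtain ⟨g₁, hm₁, hle₁, hint₁⟩ := hE A₁ K₁ hb₁ h₁
  obtain ⟨g₂, hm₂, hle₂, hint₂⟩ := hE A₂ K₂ hb₂ h₂
  set B := (c : ℝ≥0∞) * (K₁ * volume A₁ + K₂ * volume A₂) with hB
  have hBtop : B ≠ ⊤ := by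
    refine ENNReal.mul_ne_top ENNReal.coe_ne_top (ENNReal.add_ne_top.2 ⟨?_, ?_⟩)
    · exact ENNReal.mul_ne_top ENNReal.coe_ne_top hb₁.measure_lt_top.ne
    · exact ENNReal.mul_ne_top ENNReal.coe_ne_top hb₂.measure_lt_top.ne
  set I : Set ℝ := Ioo (1 / 16 : ℝ) (1 / 8) with hI
  have hvI : volume I = (16 : ℝ≥0∞)⁻¹ := by
    rw [hI, Real.volume_Ioo, show (1 / 8 - 1 / 16 : ℝ) = (16 : ℝ)⁻¹ by norm_num,
      ENNReal.ofReal_inv_of_pos (by norm_num)]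
    simp
  have hup : ∫⁻ l in I, μH[(m : ℝ)] {x | x ∈ A₁ ∪ A₂ ∧ q x = l} ≤ B := by
    calc ∫⁻ l in I, μH[(m : ℝ)] {x | x ∈ A₁ ∪ A₂ ∧ q x = l}
        ≤ ∫⁻ l, μH[(m : ℝ)] {x | x ∈ A₁ ∪ A₂ ∧ q x = l} := setLIntegral_le_lintegral _ _
      _ ≤ ∫⁻ l, (g₁ l + g₂ l) := by
          refine lintegral_mono fun l => ?_
          have e : {x | x ∈ A₁ ∪ A₂ ∧ q x = l} =
              {x | x ∈ A₁ ∧ q x = l} ∪ {x | x ∈ A₂ ∧ q x = l} := by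
            ext x; simp only [mem_union, mem_ofPred_eq]; tauto
          rw [e]
          exact (measure_union_le _ _).trans (add_le_add (hle₁ l) (hle₂ l))
      _ = (∫⁻ l, g₁ l) + ∫⁻ l, g₂ l := lintegral_add_left hm₁ _
      _ ≤ B := by
          rw [hB, mul_add]
          exact add_le_add hint₁ hint₂
  have hlow : B + ε * (16 : ℝ≥0∞)⁻¹ ≤ ∫⁻ l in I, μH[(m : ℝ)] {x | x ∈ A₁ ∪ A₂ ∧ q x = l} := by
    have : ∫⁻ _ in I, (16 * B + ε) ≤
        ∫⁻ l in I, μH[(m : ℝ)] {x | x ∈ A₁ ∪ A₂ ∧ q x = l} := by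
      refine lintegral_mono_ae ((ae_restrict_iff' measurableSet_Ioo).2 ?_)
      filter_upwards [hp] with l hl hlI
      refine le_trans (le_of_eq ?_) (hcon l hlI hl).le
      rw [hB]; push_cast; ring
    refine le_trans (le_of_eq ?_) this
    rw [setLIntegral_const, hvI, add_mul, mul_right_comm,
      ENNReal.mul_inv_cancel (by norm_num) (by norm_num), one_mul]
  have := hlow.trans hup
  have h2 : B < B + ε * (16 : ℝ≥0∞)⁻¹ :=
    ENNReal.lt_add_right hBtop (mul_ne_zero hε.ne' (by norm_num))
  exact absurd this (not_le.2 h2)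

theorem lipschitzOnWith_of_norm_fderiv_le_ball {n : ℕ} {g : Eucl n → ℝ} (hg : ContDiff ℝ 1 g)
    {r : ℝ} {K : ℝ≥0} (h : ∀ x ∈ ball (0 : Eucl n) r, ‖fderiv ℝ g x‖ ≤ K) :
    LipschitzOnWith K g (ball 0 r) :=
  (convex_ball _ _).lipschitzOnWith_of_nnnorm_fderiv_le
    (fun x _ => hg.differentiable (by norm_num) x) fun x hx => h x hx

theorem lipschitzWith_inner_left {n : ℕ} (w : Eucl n) :
    LipschitzWith ‖w‖₊ fun x : Eucl n => ⟪w, x⟫ := by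
  refine LipschitzWith.of_dist_le_mul fun x y => ?_
  rw [Real.dist_eq, ← inner_sub_right, dist_eq_norm]
  exact abs_real_inner_le_norm _ _

theorem le_iff_of_truncation {χ : ℝ → ℝ} (h₁ : ∀ t ≤ 1 / 2, χ t = t)
    (h₂ : ∀ t, 1 / 2 ≤ t → 1 / 2 ≤ χ t) {s μ : ℝ} (hμ : μ < 1 / 2) : χ s ≤ μ ↔ s ≤ μ := by
  rcases le_total s (1 / 2) with h | h
  · rw [h₁ s h]
  · have := h₂ s h
    constructor <;> intro h' <;> linarith

set_option maxHeartbeats 1000000 in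
/-- Filling in a `C¹` sublevel set inside a thin shell: the new boundary inside the shell is
controlled by the volume of the complement in the shell. -/
theorem exists_shell_surgery (m : ℕ) : ∃ C₀ : ℝ≥0, ∀ (f : Eucl (m + 1) → ℝ)
    (G : Set (Eucl (m + 1))) (r L D η a δ κ : ℝ) (C : ℝ≥0) (ε : ℝ≥0∞), ContDiff ℝ 1 f →
    (∀ x, x ∈ G ↔ f x ≤ 0) → (∀ x, f x = 0 → fderiv ℝ f x ≠ 0) → 0 ≤ a → 0 < δ → a + δ ≤ r →
    0 ≤ L → (∀ x ∈ ball 0 (r + 1), ‖fderiv ℝ f x‖ ≤ L) → 0 < η → 0 < κ → κ ≤ δ → D * κ < δ / 4 →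
    C₀ * κ ≤ η * δ →
    (∀ W, ContDiff ℝ 1 W → (∀ x ∈ ball 0 (r + 1), |W x - f x| ≤ κ) →
      (∀ x ∈ ball 0 (r + 1), ‖fderiv ℝ W x - fderiv ℝ f x‖ ≤ η) → ∀ S ⊆ closedBall 0 r,
      (∀ x ∈ S, W x = 0) →
      μH[(m : ℝ)] S ≤ C * μH[(m : ℝ)] {y | f y = 0 ∧ ∃ x ∈ S, dist y x ≤ D * κ}) →
    (∀ x ∈ closedBall 0 r, |f x| ≤ κ → 2 * η ≤ ‖fderiv ℝ f x‖) → 0 < ε →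
    ∃ F, HasC1Boundary F ∧ ball 0 a ⊆ F ∧ (∀ x, a + 3 / 4 * δ < ‖x‖ → (x ∈ F ↔ x ∈ G)) ∧
      μH[(m : ℝ)] (frontier F ∩ closedBall 0 (a + 3 / 4 * δ)) ≤
        C * μH[(m : ℝ)] {y | f y = 0 ∧ a < ‖y‖ ∧ ‖y‖ < a + δ} +
        (C₀ * (ENNReal.ofReal ((L + 1) / κ) *
            volume {x : Eucl (m + 1) | (a < ‖x‖ ∧ ‖x‖ < a + δ) ∧ |f x| ≤ 2 * κ} +
          ENNReal.ofReal (1 / δ) *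
            volume {x : Eucl (m + 1) | (a < ‖x‖ ∧ ‖x‖ < a + δ) ∧ 0 < f x}) + ε) := by
  obtain ⟨c, hlevel⟩ := exists_level_hausdorffMeasure_le m
  obtain ⟨K₀, hcut⟩ := exists_radial_cutoff
  obtain ⟨χ, Kχ, hχ, hχL, hχlow, hχhigh, hχhalf, hχ1⟩ := exists_smooth_truncation
  set C₁ : ℝ≥0 := Kχ + 8 * K₀ + 1 with hC₁
  refine ⟨c * C₁ + 16 * K₀, ?_⟩
  intro f G r L D η a δ κ C ε hf hG hreg ha hδ har hL hfL hη hκ hκδ hDκ hC₀ hb hc hε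
  have hC₀' : 16 * (K₀ : ℝ) * κ ≤ η * δ := by
    refine le_trans ?_ hC₀
    push_cast
    have : 0 ≤ (c : ℝ) * C₁ * κ := by positivity
    nlinarith
  have hr1 : 0 < r + 1 := by linarith
  obtain ⟨Ψ, hΨs, hΨL, hΨ0, hΨ1, hΨin, hΨout⟩ :=
    hcut (m + 1) (a + 1 / 8 * δ) (a + 3 / 8 * δ) (by linarith) (by linarith)
  obtain ⟨φ, hφs, hφL, hφ0, hφ1, hφin, hφout⟩ :=
    hcut (m + 1) (a + 5 / 8 * δ) (a + 3 / 4 * δ) (by linarith) (by linarith)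
  -- the `C²` approximation of `f`
  set ε₁ := min (κ / 64) (min (η / 4) 1) with hε₁
  have hε₁0 : 0 < ε₁ := by positivity
  have hε₁κ : ε₁ ≤ κ / 64 := min_le_left _ _
  have hε₁η : ε₁ ≤ η / 4 := (min_le_right _ _).trans (min_le_left _ _)
  have hε₁1 : ε₁ ≤ 1 := (min_le_right _ _).trans (min_le_right _ _)
  obtain ⟨g, hg, hgf⟩ := exists_contDiff_approx hf hr1 hε₁0
  have hg1 : ContDiff ℝ 1 g := hg.of_le (by norm_num)
  set q₀ : Eucl (m + 1) → ℝ := fun x => χ (κ⁻¹ * g x) - 2 * Ψ x with hq₀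
  have hq₀s : ContDiff ℝ 2 q₀ := by
    have : ContDiff ℝ 2 fun x => χ (κ⁻¹ * g x) := hχ.comp (by fun_prop)
    fun_prop
  -- the choice of the slope
  set ω := min (1 / (64 * (r + 1))) (min (1 / δ) (η / (4 * κ))) with hω
  have hω0 : 0 < ω := by positivity
  obtain ⟨w, hwball, hw⟩ := Metric.dense_iff.1
    (Measure.dense_of_ae (ae_ae_fderiv_sub_inner_ne_zero hq₀s)) 0 ω hω0
  have hwω : ‖w‖ ≤ ω := by rw [mem_ball_zero_iff] at hwball; exact hwball.le
  have hwr : ‖w‖ * (r + 1) ≤ 1 / 64 := by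
    have : ‖w‖ ≤ 1 / (64 * (r + 1)) := hwω.trans (min_le_left _ _)
    calc ‖w‖ * (r + 1) ≤ 1 / (64 * (r + 1)) * (r + 1) := by gcongr
      _ = 1 / 64 := by field_simp
  have hwδ : ‖w‖ ≤ 1 / δ := hwω.trans ((min_le_right _ _).trans (min_le_left _ _))
  have hwη : κ * ‖w‖ ≤ η / 4 := by
    have : ‖w‖ ≤ η / (4 * κ) := hwω.trans ((min_le_right _ _).trans (min_le_right _ _))
    calc κ * ‖w‖ ≤ κ * (η / (4 * κ)) := by gcongr
      _ = η / 4 := by field_simp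
  have hinner : ∀ x : Eucl (m + 1), ‖x‖ < r + 1 → |⟪w, x⟫| ≤ 1 / 64 := fun x hx =>
    (abs_real_inner_le_norm _ _).trans (le_trans (by gcongr) hwr)
  set q : Eucl (m + 1) → ℝ := fun x => q₀ x - ⟪w, x⟫ with hq
  have hinner_s : ContDiff ℝ 2 fun x : Eucl (m + 1) => ⟪w, x⟫ :=
    contDiff_const.inner ℝ contDiff_id
  have hqs : ContDiff ℝ 2 q := hq₀s.sub hinner_s
  -- the choice of the level
  set A₁ := {x : Eucl (m + 1) | (a < ‖x‖ ∧ ‖x‖ < a + δ) ∧ |f x| ≤ 2 * κ} with hA₁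
  set A₂ := {x : Eucl (m + 1) | (a < ‖x‖ ∧ ‖x‖ < a + δ) ∧ 2 * κ < f x} with hA₂
  have hball : ∀ x : Eucl (m + 1), ‖x‖ < a + δ → x ∈ ball (0 : Eucl (m + 1)) (r + 1) :=
    fun x hx => by rw [mem_ball_zero_iff]; linarith
  have hΨw : ∀ x y, |(2 * Ψ x + ⟪w, x⟫) - (2 * Ψ y + ⟪w, y⟫)| ≤
      (8 * K₀ + 1) * (1 / δ) * dist x y := by
    intro x y
    have h1 := hΨL.dist_le_mul x y
    have h2 := (lipschitzWith_inner_left w).dist_le_mul x y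
    rw [NNReal.coe_div, Real.coe_toNNReal _ (by linarith), Real.dist_eq,
      show a + 3 / 8 * δ - (a + 1 / 8 * δ) = δ / 4 by ring] at h1
    rw [Real.dist_eq, coe_nnnorm] at h2
    have h3 : ‖w‖ * dist x y ≤ 1 / δ * dist x y := by gcongr
    have e : (2 * Ψ x + ⟪w, x⟫) - (2 * Ψ y + ⟪w, y⟫) =
        2 * (Ψ x - Ψ y) + (⟪w, x⟫ - ⟪w, y⟫) := by ring
    rw [e]
    refine (abs_add_le _ _).trans ?_
    rw [abs_mul, abs_two]
    have e2 : (K₀ : ℝ) / (δ / 4) * dist x y = 4 * K₀ * (1 / δ) * dist x y := by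
      field_simp
    rw [e2] at h1
    linarith
  have hlip₁ : LipschitzOnWith (C₁ * ((L + 1) / κ).toNNReal) q A₁ := by
    have hgL : LipschitzOnWith (L + 1).toNNReal g (ball 0 (r + 1)) := by
      refine lipschitzOnWith_of_norm_fderiv_le_ball hg1 fun x hx => ?_
      rw [Real.coe_toNNReal _ (by linarith)]
      have h1 := (hgf x hx).2
      have h2 := norm_le_norm_add_norm_sub' (fderiv ℝ g x) (fderiv ℝ f x)
      have h3 := hfL x hx
      linarith
    refine LipschitzOnWith.of_dist_le_mul fun x hx y hy => ?_
    have h1 := hgL.dist_le_mul x (hball x hx.1.2) y (hball y hy.1.2)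
    have h2 := hχL.dist_le_mul (κ⁻¹ * g x) (κ⁻¹ * g y)
    rw [Real.coe_toNNReal _ (by linarith)] at h1
    rw [Real.dist_eq (κ⁻¹ * g x), ← mul_sub, abs_mul, ← Real.dist_eq,
      abs_of_pos (inv_pos.2 hκ), Real.dist_eq] at h2
    have h3 := hΨw x y
    have h4 : (Kχ : ℝ) * (κ⁻¹ * dist (g x) (g y)) ≤ Kχ * ((L + 1) / κ) * dist x y := by
      calc (Kχ : ℝ) * (κ⁻¹ * dist (g x) (g y)) ≤ Kχ * (κ⁻¹ * ((L + 1) * dist x y)) := by gcongr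
        _ = _ := by field_simp
    have h5 : 1 / δ ≤ (L + 1) / κ := by
      rw [div_le_div_iff₀ hδ hκ]; nlinarith
    have h6 : (8 * (K₀ : ℝ) + 1) * (1 / δ) * dist x y ≤
        (8 * K₀ + 1) * ((L + 1) / κ) * dist x y := by gcongr
    rw [NNReal.coe_mul, Real.coe_toNNReal _ (by positivity), hC₁, Real.dist_eq]
    push_cast
    have e : q x - q y = (χ (κ⁻¹ * g x) - χ (κ⁻¹ * g y)) -
        ((2 * Ψ x + ⟪w, x⟫) - (2 * Ψ y + ⟪w, y⟫)) := by
      simp only [hq, hq₀]; ring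
    rw [e]
    refine (abs_sub _ _).trans ?_
    linarith
  have hlip₂ : LipschitzOnWith (C₁ * (1 / δ).toNNReal) q A₂ := by
    have hχone : ∀ x ∈ A₂, χ (κ⁻¹ * g x) = 1 := fun x hx => by
      refine hχhigh _ ?_
      have h1 := (abs_le.1 (hgf x (hball x hx.1.2)).1).1
      have h2 : 2 * κ < f x := hx.2
      rw [inv_mul_eq_div, le_div_iff₀ hκ]
      linarith
    refine LipschitzOnWith.of_dist_le_mul fun x hx y hy => ?_
    have h3 := hΨw x y
    rw [NNReal.coe_mul, Real.coe_toNNReal _ (by positivity), hC₁, Real.dist_eq]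
    push_cast
    have e : q x - q y = -((2 * Ψ x + ⟪w, x⟫) - (2 * Ψ y + ⟪w, y⟫)) := by
      simp only [hq, hq₀]; rw [hχone x hx, hχone y hy]; ring
    rw [e, abs_neg]
    have : 0 ≤ (Kχ : ℝ) * (1 / δ) * dist x y := by positivity
    linarith
  have hbd : ∀ s ⊆ ball (0 : Eucl (m + 1)) (r + 1), IsBounded s := fun s hs =>
    isBounded_ball.subset hs
  obtain ⟨l, ⟨hl1, hl2⟩, hl, hlH⟩ := hlevel q _ A₁ A₂ _ _ ε hw
    (hbd _ fun x hx => hball x hx.1.2) (hbd _ fun x hx => hball x hx.1.2) hlip₁ hlip₂ hε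
  have hμ : ∀ x : Eucl (m + 1), ‖x‖ < r + 1 → 1 / 32 < l + ⟪w, x⟫ ∧ l + ⟪w, x⟫ < 1 / 4 := by
    intro x hx
    have := abs_le.1 (hinner x hx)
    constructor <;> linarith [this.1, this.2]
  -- the two defining functions
  set h : Eucl (m + 1) → ℝ := fun x => g x - f x - κ * (l + ⟪w, x⟫) with hh
  set WA : Eucl (m + 1) → ℝ := fun x => f x + φ x * h x with hWA
  set WB : Eucl (m + 1) → ℝ := fun x => q x - l with hWB
  have hhs : ContDiff ℝ 1 h := by
    have := hinner_s.of_le (show (1 : WithTop ℕ∞) ≤ 2 by norm_num)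
    fun_prop
  have hφ1s : ContDiff ℝ 1 φ := hφs.of_le (by norm_num)
  have hWAs : ContDiff ℝ 1 WA := hf.add (hφ1s.mul hhs)
  have hWBs : ContDiff ℝ 1 WB := (hqs.of_le (by norm_num)).sub contDiff_const
  have hWAout : ∀ x, a + 3 / 4 * δ ≤ ‖x‖ → WA x = f x := fun x hx => by
    simp only [hWA]; rw [hφout x hx]; ring
  have hagree : ∀ x : Eucl (m + 1), a + 3 / 8 * δ ≤ ‖x‖ → ‖x‖ ≤ a + 5 / 8 * δ →
      (WA x ≤ 0 ↔ WB x ≤ 0) := by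
    intro x hx1 hx2
    have h1 : WA x = κ * (κ⁻¹ * g x - (l + ⟪w, x⟫)) := by
      simp only [hWA, hh]; rw [hφin x hx2]; field_simp; ring
    have h2 : WB x = χ (κ⁻¹ * g x) - (l + ⟪w, x⟫) := by
      simp only [hWB, hq, hq₀]; rw [hΨout x hx1]; ring
    rw [h1, h2, mul_nonpos_iff_pos_imp_nonpos, sub_nonpos, sub_nonpos,
      le_iff_of_truncation hχlow hχhalf (by linarith [(hμ x (by linarith)).2])]
    constructor
    · intro h'; exact h'.1 hκ
    · intro h'; exact ⟨fun _ => h', fun _ => hκ.le⟩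
  have hhb : ∀ x ∈ ball (0 : Eucl (m + 1)) (r + 1), |h x| ≤ κ := by
    intro x hx
    have h1 := abs_le.1 (hgf x hx).1
    have h2 := hμ x (mem_ball_zero_iff.1 hx)
    have h3 : 0 ≤ κ * (l + ⟪w, x⟫) := mul_nonneg hκ.le (by linarith [h2.1])
    have h4 : κ * (l + ⟪w, x⟫) ≤ κ * (1 / 4) := by gcongr; exact h2.2.le
    simp only [hh]
    rw [abs_le]
    constructor <;> linarith [h1.1, h1.2]
  have hWAf : ∀ x ∈ ball (0 : Eucl (m + 1)) (r + 1), |WA x - f x| ≤ κ := by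
    intro x hx
    simp only [hWA]
    rw [add_sub_cancel_left, abs_mul, abs_of_nonneg (hφ0 x)]
    calc φ x * |h x| ≤ 1 * κ := mul_le_mul (hφ1 x) (hhb x hx) (abs_nonneg _) zero_le_one
      _ = κ := one_mul κ
  have hWAd : ∀ x ∈ ball (0 : Eucl (m + 1)) (r + 1), ‖fderiv ℝ WA x - fderiv ℝ f x‖ ≤ η := by
    intro x hx
    have hdφ : DifferentiableAt ℝ φ x := hφ1s.differentiable (by norm_num) x
    have hdh : DifferentiableAt ℝ h x := hhs.differentiable (by norm_num) x
    have hdf : DifferentiableAt ℝ f x := hf.differentiable (by norm_num) x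
    have hdg : DifferentiableAt ℝ g x := hg1.differentiable (by norm_num) x
    have hdw : HasFDerivAt (fun y : Eucl (m + 1) => ⟪w, y⟫) (innerSL ℝ w) x :=
      (innerSL ℝ w).hasFDerivAt
    have e : fderiv ℝ WA x - fderiv ℝ f x = φ x • fderiv ℝ h x + h x • fderiv ℝ φ x := by
      have := (hdf.hasFDerivAt.add (hdφ.hasFDerivAt.mul hdh.hasFDerivAt)).fderiv
      rw [show fderiv ℝ WA x = _ from this, add_sub_cancel_left]
    have eh : fderiv ℝ h x = fderiv ℝ g x - fderiv ℝ f x - κ • innerSL ℝ w :=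
      ((hdg.hasFDerivAt.sub hdf.hasFDerivAt).sub ((hdw.const_add l).const_mul κ)).fderiv
    have h1 : ‖fderiv ℝ h x‖ ≤ η / 2 := by
      rw [eh]
      refine (norm_sub_le _ _).trans ?_
      rw [norm_smul, Real.norm_of_nonneg hκ.le, innerSL_apply_norm]
      linarith [(hgf x hx).2]
    have h2 : ‖fderiv ℝ φ x‖ ≤ 8 * K₀ / δ := by
      refine (norm_fderiv_le_of_lipschitz ℝ hφL).trans (le_of_eq ?_)
      rw [NNReal.coe_div, Real.coe_toNNReal _ (by linarith)]
      rw [show a + 3 / 4 * δ - (a + 5 / 8 * δ) = δ / 8 by ring]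
      field_simp
    rw [e]
    refine (norm_add_le _ _).trans ?_
    rw [norm_smul, norm_smul, Real.norm_of_nonneg (hφ0 x), Real.norm_eq_abs]
    have h3 : φ x * ‖fderiv ℝ h x‖ ≤ 1 * (η / 2) :=
      mul_le_mul (hφ1 x) h1 (norm_nonneg _) zero_le_one
    have h4 : |h x| * ‖fderiv ℝ φ x‖ ≤ κ * (8 * K₀ / δ) :=
      mul_le_mul (hhb x hx) h2 (norm_nonneg _) hκ.le
    have h5 : κ * (8 * K₀ / δ) ≤ η / 2 := by
      rw [mul_div_assoc', div_le_iff₀ hδ]; linarith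
    linarith
  set F : Set (Eucl (m + 1)) := {x | (‖x‖ < a + 1 / 2 * δ ∧ WB x ≤ 0) ∨
    (a + 1 / 2 * δ ≤ ‖x‖ ∧ WA x ≤ 0)} with hF
  have hFB : ∀ y ∈ {y : Eucl (m + 1) | ‖y‖ < a + 5 / 8 * δ}, y ∈ F ↔ WB y ≤ 0 := by
    intro y hy
    simp only [mem_ofPred_eq] at hy
    simp only [hF, mem_ofPred_eq]
    rcases lt_or_ge ‖y‖ (a + 1 / 2 * δ) with h' | h'
    · refine ⟨?_, fun h1 => Or.inl ⟨h', h1⟩⟩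
      rintro (h1 | h1)
      · exact h1.2
      · exact absurd h1.1 (not_le.2 h')
    · rw [← hagree y (by linarith) hy.le]
      refine ⟨?_, fun h1 => Or.inr ⟨h', h1⟩⟩
      rintro (h1 | h1)
      · exact absurd h1.1 (not_lt.2 h')
      · exact h1.2
  have hFA : ∀ y ∈ {y : Eucl (m + 1) | a + 3 / 8 * δ < ‖y‖}, y ∈ F ↔ WA y ≤ 0 := by
    intro y hy
    simp only [mem_ofPred_eq] at hy
    simp only [hF, mem_ofPred_eq]
    rcases lt_or_ge ‖y‖ (a + 1 / 2 * δ) with h' | h'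
    · rw [hagree y hy.le (by linarith)]
      refine ⟨?_, fun h1 => Or.inl ⟨h', h1⟩⟩
      rintro (h1 | h1)
      · exact h1.2
      · exact absurd h1.1 (not_le.2 h')
    · refine ⟨?_, fun h1 => Or.inr ⟨h', h1⟩⟩
      rintro (h1 | h1)
      · exact absurd h1.1 (not_lt.2 h')
      · exact h1.2
  have hUB : IsOpen {y : Eucl (m + 1) | ‖y‖ < a + 5 / 8 * δ} :=
    isOpen_lt continuous_norm continuous_const
  have hUA : IsOpen {y : Eucl (m + 1) | a + 3 / 8 * δ < ‖y‖} :=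
    isOpen_lt continuous_const continuous_norm
  have hregB : ∀ y, WB y = 0 → fderiv ℝ WB y ≠ 0 := by
    intro y hy
    have h1 := hl y (by simp only [hWB, hq] at hy; linarith)
    simp only [hWB]
    rwa [fderiv_sub_const]
  have hregA : ∀ y, WA y = 0 → fderiv ℝ WA y ≠ 0 := by
    intro y hy
    rcases lt_or_ge (a + 3 / 4 * δ) ‖y‖ with h' | h'
    · have hev : WA =ᶠ[𝓝 y] f := by
        filter_upwards [(continuous_norm.tendsto y).eventually (lt_mem_nhds h')] with z hz
        exact hWAout z hz.le
      rw [hev.fderiv_eq]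
      exact hreg y (by rw [← hWAout y h'.le, hy])
    · intro h0
      have hyb : y ∈ ball (0 : Eucl (m + 1)) (r + 1) := hball y (by linarith)
      have h1 := hWAf y hyb
      rw [hy, zero_sub, abs_neg] at h1
      have h2 := hc y (by rw [mem_closedBall_zero_iff]; linarith) h1
      have h3 := hWAd y hyb
      rw [h0, zero_sub, norm_neg] at h3
      linarith
  have hin : ∀ x, ‖x‖ ≤ a + 1 / 8 * δ → WB x < 0 := by
    intro x hx
    have h1 := hμ x (by linarith)
    have h2 := hχ1 (κ⁻¹ * g x)
    simp only [hWB, hq, hq₀]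
    rw [hΨin x hx]
    linarith
  refine ⟨F, hasC1Boundary_of_local fun x => ?_, fun x hx => ?_, fun x hx => ?_, ?_⟩
  · rcases lt_or_ge ‖x‖ (a + 1 / 2 * δ) with h' | h'
    · exact ⟨_, WB, hUB, by simp only [mem_ofPred_eq]; linarith, hWBs, hFB, fun y _ => hregB y⟩
    · exact ⟨_, WA, hUA, by simp only [mem_ofPred_eq]; linarith, hWAs, hFA, fun y _ => hregA y⟩
  · rw [mem_ball_zero_iff] at hx
    exact (hFB x (by simp only [mem_ofPred_eq]; linarith)).2 (hin x (by linarith)).le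
  · rw [hFA x (by simp only [mem_ofPred_eq]; linarith), hWAout x hx.le, hG]
  · set SA := {x : Eucl (m + 1) | (a + 1 / 2 * δ ≤ ‖x‖ ∧ ‖x‖ ≤ a + 3 / 4 * δ) ∧ WA x = 0} with hSA
    have hsub : frontier F ∩ closedBall 0 (a + 3 / 4 * δ) ⊆
        SA ∪ {x | x ∈ A₁ ∪ A₂ ∧ q x = l} := by
      rintro x ⟨hx, hxr⟩
      rw [mem_closedBall_zero_iff] at hxr
      rcases lt_or_ge ‖x‖ (a + 1 / 2 * δ) with h' | h'
      · have hB0 : WB x = 0 := eq_zero_of_mem_frontier hUB hWBs.continuous hFB hx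
          (by simp only [mem_ofPred_eq]; linarith)
        have hxa : a < ‖x‖ := by
          by_contra! hcon
          linarith [hin x (by linarith)]
        have hxb : x ∈ ball (0 : Eucl (m + 1)) (r + 1) := hball x (by linarith)
        have hgx : 0 < κ⁻¹ * g x := by
          by_contra! hcon
          have h1 := hχlow _ (hcon.trans (by norm_num))
          have h2 := hμ x (by linarith)
          have h3 := hΨ0 x
          simp only [hWB, hq, hq₀] at hB0
          linarith
        have hgx' : 0 < g x := (mul_pos_iff_of_pos_left (inv_pos.2 hκ)).1 hgx
        have hfx := (abs_le.1 (hgf x hxb).1).2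
        refine Or.inr ⟨?_, by simp only [hWB] at hB0; linarith⟩
        rcases le_or_gt (f x) (2 * κ) with h2 | h2
        · exact Or.inl ⟨⟨hxa, by linarith⟩, abs_le.2 ⟨by linarith, h2⟩⟩
        · exact Or.inr ⟨⟨hxa, by linarith⟩, h2⟩
      · exact Or.inl ⟨⟨h', hxr⟩, eq_zero_of_mem_frontier hUA hWAs.continuous hFA hx
          (by simp only [mem_ofPred_eq]; linarith)⟩
    have hHA : μH[(m : ℝ)] SA ≤ C * μH[(m : ℝ)] {y | f y = 0 ∧ a < ‖y‖ ∧ ‖y‖ < a + δ} := by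
      refine (hb WA hWAs hWAf hWAd SA (fun x hx => ?_) fun x hx => hx.2).trans ?_
      · rw [mem_closedBall_zero_iff]
        linarith [hx.1.2]
      · gcongr
        rintro ⟨x, hx, hxy⟩
        have h1 := hx.1.1
        have h2 := hx.1.2
        rw [dist_eq_norm] at hxy
        have h3 := abs_le.1 (abs_norm_sub_norm_le _ x |>.trans hxy)
        constructor <;> linarith [h3.1, h3.2]
    refine (measure_mono hsub).trans ((measure_union_le _ _).trans (add_le_add hHA (hlH.trans ?_)))
    gcongr ?_ + ε
    have hsub₂ : A₂ ⊆ {x : Eucl (m + 1) | (a < ‖x‖ ∧ ‖x‖ < a + δ) ∧ 0 < f x} := fun x hx =>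
      ⟨hx.1, lt_trans (by linarith) hx.2⟩
    have hcc : (c * C₁ : ℝ≥0) ≤ c * C₁ + 16 * K₀ := le_self_add
    calc (c : ℝ≥0∞) * (↑(C₁ * ((L + 1) / κ).toNNReal) * volume A₁ +
          ↑(C₁ * (1 / δ).toNNReal) * volume A₂)
        = (c * C₁ : ℝ≥0) * (ENNReal.ofReal ((L + 1) / κ) * volume A₁ +
          ENNReal.ofReal (1 / δ) * volume A₂) := by
          simp only [ENNReal.coe_mul, ENNReal.ofReal]; ring
      _ ≤ _ := by gcongr

theorem sum_measure_shell_le {n : ℕ} (μ : Measure (Eucl n)) (A : Set (Eucl n)) {a δ r : ℝ} {N : ℕ}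
    (hδ : 0 < δ) (hr : a + N * δ ≤ r) :
    ∑ i ∈ Finset.range N, μ {x | (a + i * δ < ‖x‖ ∧ ‖x‖ < a + i * δ + δ) ∧ x ∈ A} ≤
      μ (ball 0 r ∩ A) := by
  set S : ℕ → Set (Eucl n) := fun i => {x | a + i * δ < ‖x‖ ∧ ‖x‖ < a + i * δ + δ} with hS
  have hSm : ∀ i, MeasurableSet (S i) := fun i =>
    ((isOpen_lt continuous_const continuous_norm).inter
      (isOpen_lt continuous_norm continuous_const)).measurableSet
  have hlt : ∀ i j : ℕ, i < j → Disjoint (S i) (S j) := fun i j hij => by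
    rw [Set.disjoint_left]
    intro x hi hj
    have h1 : ‖x‖ < a + i * δ + δ := hi.2
    have h2 : a + j * δ < ‖x‖ := hj.1
    have h3 : (i : ℝ) + 1 ≤ j := by exact_mod_cast hij
    nlinarith
  have hdisj : (↑(Finset.range N) : Set ℕ).PairwiseDisjoint S := by
    intro i _ j _ hij
    rcases lt_or_gt_of_ne hij with h | h
    · exact hlt i j h
    · exact (hlt j i h).symm
  have h1 := measure_biUnion_finset (μ := μ.restrict A) hdisj fun i _ => hSm i
  have h2 : ∀ i : ℕ, μ {x | (a + i * δ < ‖x‖ ∧ ‖x‖ < a + i * δ + δ) ∧ x ∈ A} = μ.restrict A (S i) :=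
    fun i => (Measure.restrict_apply (hSm i)).symm
  simp only [h2]
  rw [← h1, ← Measure.restrict_apply isOpen_ball.measurableSet]
  refine measure_mono (iUnion₂_subset fun i hi x hx => ?_)
  have h3 : (i : ℝ) + 1 ≤ N := by exact_mod_cast Finset.mem_range.1 hi
  have h4 : ‖x‖ < a + i * δ + δ := hx.2
  rw [mem_ball_zero_iff]
  nlinarith

/-- Filling in a set with `C¹` boundary up to a well chosen radius: the new boundary is controlled
by the volume of the complement. -/
theorem exists_filling (m : ℕ) : ∃ C₀ : ℝ≥0, ∀ (G : Set (Eucl (m + 1))) (r₁ r₂ R ε : ℝ),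
    HasC1Boundary G → 0 < r₁ → r₁ < r₂ → r₂ < R → μH[(m : ℝ)] (frontier G ∩ ball 0 R) ≠ ⊤ →
    0 < ε → ∃ ρ ∈ Icc r₁ r₂, ∃ F, HasC1Boundary F ∧ ball 0 (ρ - ε) ⊆ F ∧ ball 0 r₁ ⊆ F ∧
      (∀ x, ρ < ‖x‖ → (x ∈ F ↔ x ∈ G)) ∧ μH[(m : ℝ)] (frontier F ∩ closedBall 0 ρ) ≤
        C₀ * ENNReal.ofReal (1 / (r₂ - r₁)) * volume (ball 0 r₂ \ G) + ENNReal.ofReal ε := by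
  obtain ⟨C₀, hshell⟩ := exists_shell_surgery m
  refine ⟨C₀, fun G r₁ r₂ R ε hG hr₁ hr₁₂ hr₂R hHG hε => ?_⟩
  obtain ⟨f, hf, hGf, hreg⟩ := hG.exists_global
  have hK : IsCompact (closedBall (0 : Eucl (m + 1)) r₂) := isCompact_closedBall _ _
  have hKZ : ∀ x ∈ closedBall (0 : Eucl (m + 1)) r₂, ball (0 : Eucl (m + 1)) (r₂ + 1) ∈ 𝓝 x :=
    fun x hx => isOpen_ball.mem_nhds (closedBall_subset_ball (by linarith) hx)
  obtain ⟨C, D, η, κ₀, hD, hη, hκ₀, hta, htb, htc⟩ :=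
    tubeBounds_of_isCompact hf hreg hK hKZ (m.cast_nonneg (α := ℝ))
  obtain ⟨L', hL'⟩ := (isCompact_closedBall (0 : Eucl (m + 1)) (r₂ + 1)).exists_bound_of_continuousOn
    (hf.continuous_fderiv (by norm_num)).continuousOn
  set L := max L' 0 with hLdef
  have hL : 0 ≤ L := le_max_right _ _
  have hfL : ∀ x ∈ ball (0 : Eucl (m + 1)) (r₂ + 1), ‖fderiv ℝ f x‖ ≤ L := fun x hx =>
    (hL' x (ball_subset_closedBall hx)).trans (le_max_left _ _)
  set M : ℝ≥0∞ := C * μH[(m : ℝ)] (frontier G ∩ ball 0 R) +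
    C₀ * (C * ENNReal.ofReal (2 * (L + 1))) with hM
  have hMtop : M ≠ ⊤ := ENNReal.add_ne_top.2 ⟨ENNReal.mul_ne_top ENNReal.coe_ne_top hHG,
    ENNReal.mul_ne_top ENNReal.coe_ne_top (ENNReal.mul_ne_top ENNReal.coe_ne_top
      ENNReal.ofReal_ne_top)⟩
  obtain ⟨N, hN⟩ := exists_nat_gt (max (M.toReal / (ε / 2)) ((r₂ - r₁) / ε))
  have hN0 : (0 : ℝ) < N := lt_of_le_of_lt
    (le_max_of_le_right (div_nonneg (by linarith) hε.le)) hN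
  have hNM : M ≤ N * ENNReal.ofReal (ε / 2) := by
    have h1 := (le_max_left _ _).trans_lt hN
    rw [div_lt_iff₀ (by positivity)] at h1
    rw [← ENNReal.ofReal_natCast, ← ENNReal.ofReal_mul hN0.le, ← ENNReal.ofReal_toReal hMtop]
    exact ENNReal.ofReal_le_ofReal h1.le
  set δ := (r₂ - r₁) / N with hδdef
  have hδ : 0 < δ := div_pos (by linarith) hN0
  have hNδ : N * δ = r₂ - r₁ := by rw [hδdef]; field_simp
  have hδε : δ ≤ ε := by
    have h1 := (le_max_right _ _).trans_lt hN
    rw [div_lt_iff₀ hε] at h1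
    rw [hδdef, div_le_iff₀ hN0]; linarith
  set κ := min (κ₀ / 2) (min δ (min (δ / (8 * D)) (η * δ / (C₀ + 1)))) with hκdef
  have hκ : 0 < κ := by positivity
  have hκκ₀ : κ ≤ κ₀ / 2 := min_le_left _ _
  have hκδ : κ ≤ δ := (min_le_right _ _).trans (min_le_left _ _)
  have hκD : D * κ < δ / 4 := by
    have : κ ≤ δ / (8 * D) := (min_le_right _ _).trans ((min_le_right _ _).trans (min_le_left _ _))
    rw [le_div_iff₀ (by positivity)] at this
    linarith
  have hκC : C₀ * κ ≤ η * δ := by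
    have : κ ≤ η * δ / (C₀ + 1) :=
      (min_le_right _ _).trans ((min_le_right _ _).trans (min_le_right _ _))
    rw [le_div_iff₀ (by positivity)] at this
    linarith
  set X : ℝ≥0∞ := C₀ * ENNReal.ofReal (1 / (r₂ - r₁)) * volume (ball 0 r₂ \ G) with hX
  set Sh : ℕ → Set (Eucl (m + 1)) :=
    fun i => {x | r₁ + i * δ < ‖x‖ ∧ ‖x‖ < r₁ + i * δ + δ} with hSh
  set T : ℕ → ℝ≥0∞ := fun i =>
    C * μH[(m : ℝ)] {x | (r₁ + i * δ < ‖x‖ ∧ ‖x‖ < r₁ + i * δ + δ) ∧ x ∈ {y | f y = 0}} +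
    C₀ * (ENNReal.ofReal ((L + 1) / κ) *
      volume {x | (r₁ + i * δ < ‖x‖ ∧ ‖x‖ < r₁ + i * δ + δ) ∧ x ∈ {y | |f y| ≤ 2 * κ}} +
      ENNReal.ofReal (1 / δ) *
      volume {x | (r₁ + i * δ < ‖x‖ ∧ ‖x‖ < r₁ + i * δ + δ) ∧ x ∈ {y | 0 < f y}}) with hT
  have hsum : ∑ i ∈ Finset.range N, T i ≤ M + N * X := by
    have hNr : r₁ + N * δ ≤ r₂ := by linarith
    simp only [hT, Finset.sum_add_distrib, ← Finset.mul_sum]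
    have h1 := sum_measure_shell_le (n := m + 1) (μH[(m : ℝ)]) {y | f y = 0} hδ hNr
    have h2 := sum_measure_shell_le (n := m + 1) volume {y | |f y| ≤ 2 * κ} hδ hNr
    have h3 := sum_measure_shell_le (n := m + 1) volume {y | 0 < f y} hδ hNr
    have h1' : ball 0 r₂ ∩ {y | f y = 0} ⊆ frontier G ∩ ball 0 R := fun x hx =>
      ⟨mem_frontier_of_fderiv_ne_zero hGf hx.2 (hreg x hx.2), ball_subset_ball hr₂R.le hx.1⟩
    have h2' : volume (ball 0 r₂ ∩ {y | |f y| ≤ 2 * κ}) ≤ C * ENNReal.ofReal (2 * κ) := by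
      refine le_trans (measure_mono fun x hx => ?_) (hta (2 * κ) (by linarith) (by linarith))
      exact ⟨ball_subset_closedBall hx.1, hx.2⟩
    have h3' : ball 0 r₂ ∩ {y | 0 < f y} = ball 0 r₂ \ G := by
      ext x
      simp only [mem_inter_iff, mem_ofPred_eq, Set.mem_sdiff, hGf, not_le]
    rw [h3'] at h3
    have e2 : ENNReal.ofReal ((L + 1) / κ) * (C * ENNReal.ofReal (2 * κ)) =
        C * ENNReal.ofReal (2 * (L + 1)) := by
      rw [mul_left_comm, ← ENNReal.ofReal_mul (by positivity)]
      congr 2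
      field_simp
    have e3 : ENNReal.ofReal (1 / δ) = N * ENNReal.ofReal (1 / (r₂ - r₁)) := by
      rw [← ENNReal.ofReal_natCast, ← ENNReal.ofReal_mul hN0.le]
      congr 1
      rw [hδdef]
      have : r₂ - r₁ ≠ 0 := by linarith
      field_simp
    calc _ ≤ C * μH[(m : ℝ)] (frontier G ∩ ball 0 R) +
          C₀ * (ENNReal.ofReal ((L + 1) / κ) * (C * ENNReal.ofReal (2 * κ)) +
          ENNReal.ofReal (1 / δ) * volume (ball 0 r₂ \ G)) := by
          gcongr
          · exact h1.trans (measure_mono h1')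
          · exact h2.trans h2'
      _ = M + N * X := by
          rw [e2, e3, hM, hX]; ring
  have hNpos : 0 < N := by exact_mod_cast hN0
  obtain ⟨i, hi, hmin⟩ := Finset.exists_min_image (Finset.range N) T
    ⟨0, Finset.mem_range.2 hNpos⟩
  have hTi : T i ≤ ENNReal.ofReal (ε / 2) + X := by
    have h1 := Finset.card_nsmul_le_sum (Finset.range N) T (T i) hmin
    rw [Finset.card_range, nsmul_eq_mul] at h1
    have h2 : (N : ℝ≥0∞) * T i ≤ N * (ENNReal.ofReal (ε / 2) + X) := by
      refine (h1.trans hsum).trans ?_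
      rw [mul_add]
      gcongr
    exact (ENNReal.mul_le_mul_iff_right (by exact_mod_cast hNpos.ne')
      (ENNReal.natCast_ne_top N)).1 h2
  have hiN : (i : ℝ) + 1 ≤ N := by exact_mod_cast Finset.mem_range.1 hi
  have hiδ : 0 ≤ (i : ℝ) * δ := by positivity
  have hiδ' : r₁ + i * δ + δ ≤ r₂ := by nlinarith
  obtain ⟨F, hF1, hF2, hF3, hF4⟩ := hshell f G r₂ L D η (r₁ + i * δ) δ κ C
    (ENNReal.ofReal (ε / 2)) hf hGf hreg (by linarith) hδ hiδ' hL hfL hη hκ hκδ hκD hκC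
    (htb κ hκ (by linarith)) (fun x hx hfx => htc x hx (by linarith)) (by simpa using hε)
  refine ⟨r₁ + i * δ + 3 / 4 * δ, ⟨by linarith, by linarith⟩, F, hF1,
    (ball_subset_ball (by linarith)).trans hF2, (ball_subset_ball (by linarith)).trans hF2, hF3, ?_⟩
  refine hF4.trans ?_
  have e : {y : Eucl (m + 1) | f y = 0 ∧ r₁ + i * δ < ‖y‖ ∧ ‖y‖ < r₁ + i * δ + δ} =
      {x | (r₁ + i * δ < ‖x‖ ∧ ‖x‖ < r₁ + i * δ + δ) ∧ x ∈ {y | f y = 0}} := by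
    ext y; simp only [mem_ofPred_eq]; tauto
  rw [e, ← add_assoc]
  calc _ ≤ T i + ENNReal.ofReal (ε / 2) := le_rfl
    _ ≤ ENNReal.ofReal (ε / 2) + X + ENNReal.ofReal (ε / 2) := by gcongr
    _ = X + ENNReal.ofReal ε := by
      rw [show ENNReal.ofReal ε = ENNReal.ofReal (ε / 2) + ENNReal.ofReal (ε / 2) by
        rw [← ENNReal.ofReal_add (by positivity) (by positivity), add_halves]]
      ring

/-- `L¹` convergence of sets implies convergence of the volumes of relative complements. -/
theorem tendsto_volume_sdiff_of_symmDiff {n : ℕ} {G : ℕ → Set (Eucl n)} {E O B : Set (Eucl n)}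
    (h : Tendsto (fun j => volume ((G j ∆ E) ∩ O)) atTop (𝓝 0)) (hB : B ⊆ O)
    (hfin : volume B ≠ ⊤) :
    Tendsto (fun j => volume (B \ G j)) atTop (𝓝 (volume (B \ E))) := by
  have hE : volume (B \ E) ≠ ⊤ := measure_ne_top_of_subset sdiff_subset hfin
  have hl : Tendsto (fun j => volume (B \ E) - volume ((G j ∆ E) ∩ O)) atTop
      (𝓝 (volume (B \ E))) := by
    simpa using ENNReal.Tendsto.sub (tendsto_const_nhds (x := volume (B \ E))) h (Or.inl hE)
  have hu : Tendsto (fun j => volume (B \ E) + volume ((G j ∆ E) ∩ O)) atTop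
      (𝓝 (volume (B \ E))) := by
    simpa using (tendsto_const_nhds (x := volume (B \ E))).add h
  refine tendsto_of_tendsto_of_tendsto_of_le_of_le hl hu (fun j => ?_) (fun j => ?_)
  · refine tsub_le_iff_right.2 ((measure_mono fun x hx => ?_).trans (measure_union_le _ _))
    by_cases hG : x ∈ G j
    · exact Or.inr ⟨Or.inl ⟨hG, hx.2⟩, hB hx.1⟩
    · exact Or.inl ⟨hx.1, hG⟩
  · refine (measure_mono fun x hx => ?_).trans (measure_union_le _ _)
    by_cases hG : x ∈ E
    · exact Or.inr ⟨Or.inr ⟨hG, hx.2⟩, hB hx.1⟩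
    · exact Or.inl ⟨hx.1, hG⟩

/-- The volume of a spherical shell tends to zero with its thickness. -/
theorem tendsto_volume_shell {n : ℕ} {ρ : ℝ} (hρ : ρ ≠ 0) (R : ℝ) :
    Tendsto (fun δ : ℝ => volume ({x : Eucl n | |‖x‖ - ρ| ≤ δ} ∩ ball 0 R)) (𝓝 0) (𝓝 0) := by
  have : IsFiniteMeasure (volume.restrict (ball (0 : Eucl n) R)) :=
    isFiniteMeasure_restrict.2 measure_ball_lt_top.ne
  set μ : Measure ℝ := (volume.restrict (ball (0 : Eucl n) R)).map norm
  have : IsFiniteMeasure μ := Measure.isFiniteMeasure_map _ _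
  have h := tendsto_measure_cthickening_of_isClosed (μ := μ) (s := {ρ})
    ⟨1, one_pos, measure_ne_top _ _⟩ isClosed_singleton
  have h0 : μ {ρ} = 0 := by
    rw [Measure.map_apply measurable_norm (measurableSet_singleton _),
      Measure.restrict_apply (measurable_norm (measurableSet_singleton _))]
    refine measure_mono_null (t := sphere 0 ρ) (fun x hx => ?_)
      (Measure.addHaar_sphere_of_ne_zero volume 0 hρ)
    simpa using hx.1
  rw [h0] at h
  refine tendsto_of_tendsto_of_tendsto_of_le_of_le tendsto_const_nhds h (fun _ => zero_le)
    fun δ => ?_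
  have hm : MeasurableSet (cthickening δ ({ρ} : Set ℝ)) := isClosed_cthickening.measurableSet
  show volume _ ≤ μ _
  rw [Measure.map_apply measurable_norm hm, Measure.restrict_apply (measurable_norm hm)]
  refine measure_mono fun x hx => ⟨?_, hx.2⟩
  exact mem_cthickening_of_dist_le _ ρ _ _ rfl (by rw [Real.dist_eq]; exact hx.1)

theorem frontier_inter_eq_of_eqOn {X : Type*} [TopologicalSpace X] {F G U : Set X}
    (hU : IsOpen U) (h : ∀ x ∈ U, (x ∈ F ↔ x ∈ G)) : frontier F ∩ U = frontier G ∩ U := by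
  rw [← frontier_inter_open_inter hU (s := F), ← frontier_inter_open_inter hU (s := G)]
  congr 2
  ext x
  exact ⟨fun hx => ⟨(h x hx.2).1 hx.1, hx.2⟩, fun hx => ⟨(h x hx.2).2 hx.1, hx.2⟩⟩

/-- Isoperimetric comparison: if filling `G` inside `closedBall 0 ρ` almost does not decrease
the boundary measure, the volume of the filled part is controlled by the new boundary. -/
theorem volume_sdiff_pow_le_of_filling {m : ℕ} {G F : Set (Eucl (m + 1))} {s ρ R : ℝ}
    {A δ : ℝ≥0∞} (hG : IsClosed G) (hρ : ρ < R)
    (hfin : μH[(m : ℝ)] (frontier G ∩ ball 0 R) ≠ ⊤) (hball : ball 0 s ⊆ F)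
    (hout : ∀ x, ρ < ‖x‖ → (x ∈ F ↔ x ∈ G))
    (hA : μH[(m : ℝ)] (frontier F ∩ closedBall 0 ρ) ≤ A)
    (hmin : μH[(m : ℝ)] (frontier G ∩ ball 0 R) ≤ μH[(m : ℝ)] (frontier F ∩ ball 0 R) + δ)
    (hpos : volume (ball 0 s \ G) ≠ 0) :
    volume (ball 0 s \ G) ^ m ≤ (2 * A + δ) ^ (m + 1) := by
  have hUo : IsOpen {x : Eucl (m + 1) | ρ < ‖x‖} := isOpen_lt continuous_const continuous_norm
  have hfr := frontier_inter_eq_of_eqOn hUo hout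
  have hsub : closedBall (0 : Eucl (m + 1)) ρ ⊆ ball 0 R := closedBall_subset_ball hρ
  have key : ∀ H : Set (Eucl (m + 1)), μH[(m : ℝ)] (frontier H ∩ ball 0 R) =
      μH[(m : ℝ)] (frontier H ∩ closedBall 0 ρ) +
        μH[(m : ℝ)] (frontier H ∩ {x | ρ < ‖x‖} ∩ ball 0 R) := by
    intro H
    rw [← measure_inter_add_sdiff (frontier H ∩ ball 0 R)
      (isClosed_closedBall (x := (0 : Eucl (m + 1))) (ε := ρ)).measurableSet]
    congr 2
    · rw [inter_assoc, inter_eq_right.2 hsub]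
    · ext x
      simp only [Set.mem_sdiff, mem_inter_iff, mem_closedBall_zero_iff, not_le, mem_ofPred_eq]
      tauto
  have hin : μH[(m : ℝ)] (frontier G ∩ closedBall 0 ρ) ≤ A + δ := by
    rw [key G, key F, hfr, add_right_comm] at hmin
    rw [key G] at hfin
    exact ((ENNReal.add_le_add_iff_right (ENNReal.add_ne_top.1 hfin).2).1 hmin).trans
      (add_le_add_left hA _)
  set D : Set (Eucl (m + 1)) := interior F \ G
  have hDsub : ball 0 s \ G ⊆ D := sdiff_subset_sdiff_left (interior_maximal hball isOpen_ball)
  have hDo : IsOpen D := isOpen_interior.sdiff hG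
  have hDρ : D ⊆ closedBall 0 ρ := by
    intro x hx
    rw [mem_closedBall_zero_iff]
    by_contra! h
    exact hx.2 ((hout x h).1 (interior_subset hx.1))
  have hDne : D.Nonempty := (nonempty_of_measure_ne_zero hpos).mono hDsub
  have hDfr : frontier D ⊆ (frontier F ∩ closedBall 0 ρ) ∪ (frontier G ∩ closedBall 0 ρ) := by
    intro x hx
    have hxρ : x ∈ closedBall (0 : Eucl (m + 1)) ρ :=
      (closure_minimal hDρ isClosed_closedBall) (frontier_subset_closure hx)
    have : x ∈ frontier (interior F ∩ Gᶜ) := hx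
    rcases frontier_inter_subset _ _ this with h | h
    · exact Or.inl ⟨frontier_interior_subset h.1, hxρ⟩
    · exact Or.inr ⟨by simpa using h.2, hxρ⟩
  calc volume (ball 0 s \ G) ^ m ≤ volume D ^ m := by gcongr
    _ ≤ (μH[(m : ℝ)] (frontier D)) ^ (m + 1) :=
      volume_pow_le_hausdorffMeasure_frontier hDo (isBounded_closedBall.subset hDρ) hDne
    _ ≤ (2 * A + δ) ^ (m + 1) := by
      gcongr
      calc _ ≤ _ := measure_mono hDfr
        _ ≤ _ := measure_union_le _ _
        _ ≤ A + (A + δ) := add_le_add hA hin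
        _ = 2 * A + δ := by rw [two_mul, add_assoc]

/-- A set of finite relative perimeter is approximated by `C¹` sets whose boundary measures
exceed the perimeter by an arbitrarily small amount. -/
theorem exists_approx_of_Pe_ne_top {n : ℕ} {E O : Set (Eucl n)} (hE : Pe E O ≠ ⊤) {δ : ℝ≥0∞}
    (hδ : δ ≠ 0) : ∃ G : ℕ → Set (Eucl n), (∀ j, HasC1Boundary (G j)) ∧
      Tendsto (fun j => volume ((G j ∆ E) ∩ O)) atTop (𝓝 0) ∧
      ∀ j, μH[(n : ℝ) - 1] (frontier (G j) ∩ O) < Pe E O + δ := by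
  have hlt : Pe E O < Pe E O + δ := ENNReal.lt_add_right hE hδ
  obtain ⟨p, ⟨G, hG, hconv, rfl⟩, hp⟩ := sInf_lt_iff.1 (show sInf _ < Pe E O + δ from hlt)
  obtain ⟨φ, hφ, hlt⟩ := extraction_of_frequently_atTop
    (frequently_lt_of_liminf_lt (by isBoundedDefault) hp)
  exact ⟨G ∘ φ, fun j => hG _, hconv.comp hφ.tendsto_atTop, hlt⟩

/-- The relative perimeter is monotone in the open set. -/
theorem Pe_mono_set {n : ℕ} {E O O' : Set (Eucl n)} (h : O ⊆ O') : Pe E O ≤ Pe E O' := by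
  refine le_sInf ?_
  rintro p ⟨G, hG, hconv, rfl⟩
  have hconv' : Tendsto (fun j => volume ((G j ∆ E) ∩ O)) atTop (𝓝 0) :=
    tendsto_of_tendsto_of_tendsto_of_le_of_le tendsto_const_nhds hconv
      (fun _ => zero_le) fun j => measure_mono (inter_subset_inter_right _ h)
  have hle : Pe E O ≤ liminf (fun j => μH[(n : ℝ) - 1] (frontier (G j) ∩ O)) atTop :=
    sInf_le ⟨G, hG, hconv', rfl⟩
  exact hle.trans (liminf_le_liminf (Eventually.of_forall fun j =>
    measure_mono (inter_subset_inter_right _ h)))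

/-- The differential inequality, in integrated form, for a one-sided minimizer. -/
theorem volume_sdiff_pow_le_of_minimizing (m : ℕ) : ∃ C₀ : ℝ≥0, ∀ (R : ℝ)
    (E : Set (Eucl (m + 1))), MeasurableSet E → Pe E (ball 0 R) ≠ ⊤ →
    (∀ F : Set (Eucl (m + 1)), MeasurableSet F → E ⊆ F → closure (F \ E) ⊆ ball 0 R →
          Pe E (ball 0 R) ≤ Pe F (ball 0 R)) →
    ∀ s t : ℝ, 0 < s → s < t → t < R → volume (ball 0 s \ E) ≠ 0 →
      volume (ball 0 s \ E) ^ m ≤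
        (2 * (C₀ * ENNReal.ofReal (1 / (t - s)) * volume (ball 0 t \ E))) ^ (m + 1) := by
  obtain ⟨C₀, hC₀⟩ := exists_filling m
  refine ⟨C₀, fun R E hEm hPe hmin s t hs hst htR hpos => ?_⟩
  have hdim : (((m + 1 : ℕ) : ℝ) - 1) = m := by push_cast; ring
  suffices H : ∀ δ : ℝ≥0∞, δ ≠ 0 → δ ≠ ⊤ → volume (ball 0 s \ E) ^ m ≤
      (2 * (C₀ * ENNReal.ofReal (1 / (t - s)) * volume (ball 0 t \ E)) + (δ + δ)) ^ (m + 1) by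
    have hlim : Tendsto (fun k : ℕ => (2 * (C₀ * ENNReal.ofReal (1 / (t - s)) *
        volume (ball 0 t \ E)) + (((k : ℝ≥0∞)⁻¹) + ((k : ℝ≥0∞)⁻¹))) ^ (m + 1)) atTop
        (𝓝 ((2 * (C₀ * ENNReal.ofReal (1 / (t - s)) * volume (ball 0 t \ E)) + (0 + 0)) ^
          (m + 1))) :=
      ENNReal.Tendsto.pow (tendsto_const_nhds.add
        (ENNReal.tendsto_inv_nat_nhds_zero.add ENNReal.tendsto_inv_nat_nhds_zero))
    rw [add_zero, add_zero] at hlim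
    refine ge_of_tendsto hlim ?_
    filter_upwards [eventually_ge_atTop 1] with k hk
    exact H _ (ENNReal.inv_ne_zero.2 (ENNReal.natCast_ne_top k))
      (ENNReal.inv_ne_top.2 (by exact_mod_cast (by omega : k ≠ 0)))
  intro δ hδ hδt
  obtain ⟨G, hG, hconv, hlt⟩ := exists_approx_of_Pe_ne_top hPe hδ
  rw [hdim] at hlt
  have hfin : ∀ j, μH[(m : ℝ)] (frontier (G j) ∩ ball 0 R) ≠ ⊤ := fun j => (hlt j).ne_top
  have hε : ∀ j : ℕ, (0 : ℝ) < 1 / ((j : ℝ) + 1) := fun j => Nat.one_div_pos_of_nat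
  choose ρ hρ F hF hFball hFs hFout hFH using fun j =>
    hC₀ (G j) s t R (1 / ((j : ℝ) + 1)) (hG j) hs hst htR (hfin j) (hε j)
  obtain ⟨ρ', hρ', φ, hφ, hφρ⟩ := isCompact_Icc.tendsto_subseq hρ
  have hφt := hφ.tendsto_atTop
  have hε0 : Tendsto (fun j => 1 / ((φ j : ℝ) + 1)) atTop (𝓝 0) :=
    tendsto_one_div_add_atTop_nhds_zero_nat.comp hφt
  have hρ'0 : 0 < ρ' := hs.trans_le hρ'.1
  set E' : Set (Eucl (m + 1)) := E ∪ ball 0 ρ'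
  have hE' : Pe E (ball 0 R) ≤ Pe E' (ball 0 R) := by
    refine hmin E' (hEm.union isOpen_ball.measurableSet) subset_union_left ?_
    refine (closure_minimal ?_ isClosed_closedBall).trans
      (closedBall_subset_ball (hρ'.2.trans_lt htR))
    rintro x ⟨hx | hx, hxE⟩
    · exact absurd hx hxE
    · exact ball_subset_closedBall hx
  have hFconv : Tendsto (fun j => volume ((F (φ j) ∆ E') ∩ ball 0 R)) atTop (𝓝 0) := by
    have hsh : Tendsto (fun j => |ρ (φ j) - ρ'| + 1 / ((φ j : ℝ) + 1)) atTop (𝓝 0) := by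
      have h1 : Tendsto (fun j => ρ (φ j) - ρ') atTop (𝓝 0) := by
        simpa using hφρ.sub_const ρ'
      simpa using h1.abs.add hε0
    have hsum := (hconv.comp hφt).add
      ((tendsto_volume_shell (n := m + 1) hρ'0.ne' R).comp hsh)
    rw [add_zero] at hsum
    refine tendsto_of_tendsto_of_tendsto_of_le_of_le tendsto_const_nhds hsum
      (fun _ => zero_le) fun j => ?_
    refine (measure_mono fun x hx => ?_).trans (measure_union_le _ _)
    obtain ⟨hx, hxR⟩ := hx
    have hε' := hε (φ j)
    set ε' := 1 / ((φ j : ℝ) + 1)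
    set r := ρ (φ j)
    by_cases hT : |‖x‖ - ρ'| ≤ |r - ρ'| + ε'
    · exact Or.inr ⟨hT, hxR⟩
    · left
      have ha1 := le_abs_self (r - ρ')
      have ha2 := neg_abs_le (r - ρ')
      rcases lt_or_ge ‖x‖ ρ' with h | h
      · exfalso
        have hxF : x ∈ F (φ j) := by
          refine hFball (φ j) (mem_ball_zero_iff.2 ?_)
          by_contra! h'
          refine hT (abs_le.2 ⟨?_, ?_⟩)
          · change r - ε' ≤ ‖x‖ at h'
            linarith
          · linarith [abs_nonneg (r - ρ')]
        have hxE : x ∈ E' := Or.inr (mem_ball_zero_iff.2 h)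
        rcases hx with hx | hx
        · exact hx.2 hxE
        · exact hx.2 hxF
      · have hr : r < ‖x‖ := by
          by_contra! h'
          exact hT (abs_le.2 ⟨by linarith [abs_nonneg (r - ρ')], by linarith⟩)
        have hi1 := hFout (φ j) x hr
        have hi2 : x ∈ E' ↔ x ∈ E :=
          ⟨fun hx => hx.resolve_right fun hb => absurd (mem_ball_zero_iff.1 hb) h.not_gt, Or.inl⟩
        refine ⟨?_, hxR⟩
        rcases hx with hx | hx
        · exact Or.inl ⟨hi1.1 hx.1, fun hxE => hx.2 (hi2.2 hxE)⟩
        · exact Or.inr ⟨hi2.1 hx.1, fun hxG => hx.2 (hi1.2 hxG)⟩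
  have hlow : Pe E (ball 0 R) ≤
      liminf (fun j => μH[(m : ℝ)] (frontier (F (φ j)) ∩ ball 0 R)) atTop := by
    refine hE'.trans (sInf_le ⟨fun j => F (φ j), fun j => hF _, hFconv, ?_⟩)
    rw [hdim]
  have hev : ∀ᶠ j in atTop, Pe E (ball 0 R) ≤
      μH[(m : ℝ)] (frontier (F (φ j)) ∩ ball 0 R) + δ := by
    rcases eq_or_ne (Pe E (ball 0 R)) 0 with h0 | h0
    · exact Eventually.of_forall fun j => by rw [h0]; exact zero_le
    · have hlt' : Pe E (ball 0 R) - δ <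
          liminf (fun j => μH[(m : ℝ)] (frontier (F (φ j)) ∩ ball 0 R)) atTop :=
        (ENNReal.sub_lt_self hPe h0 hδ).trans_le hlow
      filter_upwards [eventually_lt_of_lt_liminf hlt'] with j hj
      exact tsub_le_iff_right.1 hj.le
  have hsR : ball (0 : Eucl (m + 1)) s ⊆ ball 0 R := ball_subset_ball (hst.trans htR).le
  have htR' : ball (0 : Eucl (m + 1)) t ⊆ ball 0 R := ball_subset_ball htR.le
  have hv := (tendsto_volume_sdiff_of_symmDiff hconv hsR measure_ball_lt_top.ne).comp hφt
  have hw := (tendsto_volume_sdiff_of_symmDiff hconv htR' measure_ball_lt_top.ne).comp hφt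
  have hε1 : Tendsto (fun j => ENNReal.ofReal (1 / ((φ j : ℝ) + 1))) atTop (𝓝 0) := by
    simpa using ENNReal.tendsto_ofReal hε0
  have hK : (C₀ : ℝ≥0∞) * ENNReal.ofReal (1 / (t - s)) ≠ ⊤ :=
    ENNReal.mul_ne_top ENNReal.coe_ne_top ENNReal.ofReal_ne_top
  have hrhs : Tendsto (fun j => (2 * (C₀ * ENNReal.ofReal (1 / (t - s)) *
      volume (ball 0 t \ G (φ j)) + ENNReal.ofReal (1 / ((φ j : ℝ) + 1))) + (δ + δ)) ^ (m + 1))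
      atTop (𝓝 ((2 * (C₀ * ENNReal.ofReal (1 / (t - s)) * volume (ball 0 t \ E) + 0) +
        (δ + δ)) ^ (m + 1))) :=
    ENNReal.Tendsto.pow ((ENNReal.Tendsto.const_mul
      ((ENNReal.Tendsto.const_mul hw (Or.inr hK)).add hε1)
      (Or.inr ENNReal.ofNat_ne_top)).add tendsto_const_nhds)
  rw [add_zero] at hrhs
  refine le_of_tendsto_of_tendsto (ENNReal.Tendsto.pow hv) hrhs ?_
  filter_upwards [hev, hv.eventually_ne hpos] with j hj hjpos
  refine volume_sdiff_pow_le_of_filling (hG _).isClosed ((hρ (φ j)).2.trans_lt htR) (hfin _)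
    (hFs _) (hFout _) (hFH _) ?_ hjpos
  rw [← add_assoc]
  exact (hlt _).le.trans (add_le_add_left hj _)

/-- **Lemma 3.3 (one-sided density estimate).** There is a dimensional constant `θ(n) > 0`
such that any one-sided perimeter minimizer in `B_R` with `0 ∈ ∂E` satisfies
`|B_r \ E| ≥ θ rⁿ` for all `0 < r < R`. -/
theorem one_sided_density_estimate (n : ℕ) :
    ∃ θ : ℝ, 0 < θ ∧
      ∀ R : ℝ, 0 < R → ∀ E : Set (Eucl n), MeasurableSet E → E ⊆ ball 0 R →
        PeT E < ⊤ → IsNormalized E → (0 : Eucl n) ∈ frontier E →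
        (∀ F : Set (Eucl n), MeasurableSet F → E ⊆ F → closure (F \ E) ⊆ ball 0 R →
          Pe E (ball 0 R) ≤ Pe F (ball 0 R)) →
        ∀ r : ℝ, 0 < r → r < R →
          ENNReal.ofReal (θ * r ^ n) ≤ volume (ball (0 : Eucl n) r \ E) := by
  rcases n with _ | m
  · refine ⟨1, one_pos, fun R _ E _ _ _ _ h0 => ?_⟩
    simp at h0
  obtain ⟨C₀, hC₀⟩ := volume_sdiff_pow_le_of_minimizing m
  obtain ⟨θ, hθ, H⟩ := growth_pow (m := m) (C := (2 * (C₀ : ℝ)) ^ (m + 1) + 1) (by positivity)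
  refine ⟨θ, hθ, fun R _ E hEm _ hPeT hnorm h0 hmin r hr hrR => ?_⟩
  have hPe : Pe E (ball 0 R) ≠ ⊤ := ((Pe_mono_set (subset_univ _)).trans_lt hPeT).ne
  have hne : ∀ s, volume (ball (0 : Eucl (m + 1)) s \ E) ≠ ⊤ := fun s =>
    measure_ne_top_of_subset sdiff_subset measure_ball_lt_top.ne
  have hpos : ∀ s, 0 < s → volume (ball (0 : Eucl (m + 1)) s \ E) ≠ 0 := by
    intro s hs h
    have h1 := ((hnorm 0).1 h0 s hs).2
    rw [← measure_inter_add_sdiff (ball (0 : Eucl (m + 1)) s) hEm, h, add_zero, inter_comm] at h1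
    exact lt_irrefl _ h1
  rw [← ENNReal.ofReal_toReal (hne r)]
  refine ENNReal.ofReal_le_ofReal
    (H (fun s => (volume (ball (0 : Eucl (m + 1)) s \ E)).toReal) R ?_ ?_ ?_ r hr hrR)
  · exact fun s hs => ENNReal.toReal_pos (hpos s hs) (hne s)
  · exact fun s t _ hst => ENNReal.toReal_mono (hne t)
      (measure_mono (sdiff_subset_sdiff_left (ball_subset_ball hst)))
  · intro s t hs hst htR
    have h := hC₀ R E hEm hPe hmin s t hs hst htR (hpos s hs)
    have hts : 0 < t - s := sub_pos.2 hst
    have h' := ENNReal.toReal_mono (ENNReal.pow_ne_top (ENNReal.mul_ne_top ENNReal.ofNat_ne_top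
      (ENNReal.mul_ne_top (ENNReal.mul_ne_top ENNReal.coe_ne_top ENNReal.ofReal_ne_top)
        (hne t)))) h
    simp only [ENNReal.toReal_pow, ENNReal.toReal_mul, ENNReal.toReal_ofNat,
      ENNReal.coe_toReal, ENNReal.toReal_ofReal (one_div_pos.2 hts).le] at h'
    have hM := ENNReal.toReal_nonneg (a := volume (ball (0 : Eucl (m + 1)) t \ E))
    set Mt := (volume (ball (0 : Eucl (m + 1)) t \ E)).toReal
    calc _ ≤ (2 * (C₀ * (1 / (t - s)) * Mt)) ^ (m + 1) * (t - s) ^ (m + 1) := by gcongr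
      _ = (2 * (C₀ : ℝ)) ^ (m + 1) * Mt ^ (m + 1) := by
        rw [← mul_pow, ← mul_pow]
        congr 1
        field_simp
      _ ≤ _ := by
        gcongr
        linarith
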